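/- arXiv:0801.2862 — 3 statements merged into one kernel-verified Lean document; each statement's English description precedes it below -/
import Mathlib

section
/- Let θ = 1/2, and let ε be a complex number satisfying either Re ε > 0 and ε⁻¹ ∉ ℤ, or Re ε = 0 and Im ε > 0. Set f(m,n) = −n(1+εn)/(1+ε(m+n)) for m,n ∈ ℤ. Suppose g: ℤ×(ℤ+θ) → ℂ, h: (ℤ+θ)×ℤ → ℂ, d: (ℤ+θ)×(ℤ+θ) → ℂ satisfy, for all m,n ∈ ℤ and r,s,t ∈ ℤ+θ: g(m,r) − h(r,m) = m/2 − r; d(r,s) + d(s,r) = 2; (m−n)g(m+n,r) = g(n,r)g(m,n+r) − g(m,r)g(n,m+r); (m/2−r)h(m+r,n) = h(r,n)g(m,n+r) − f(m,n)h(r,m+n); (m/2−r)d(m+r,s) = d(r,s)f(m,r+s) − g(m,s)d(r,m+s); 2f(r+s,m) = h(s,m)d(r,m+s) + h(r,m)d(s,m+r); 2g(r+s,t) = d(s,t)h(r,s+t) + d(r,t)h(s,r+t). Then necessarily g(m,r) = −(m/2+r)(1+2εr)/(1+2ε(m+r)), h(r,m) = −m(1+εm)/(1+2ε(m+r)), and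 d(r,s) = (1+2εs)/(1+ε(r+s)) for all m ∈ ℤ and r,s ∈ ℤ+θ. -/
/-- membership in ℤ + 1/2 -/
def InZHalf (x : ℂ) : Prop := ∃ k : ℤ, x = (k : ℂ) + 1 / 2

/-- f(m,n) = −n(1+εn)/(1+ε(m+n)) -/
noncomputable def vf (ε m n : ℂ) : ℂ := -n * (1 + ε * n) / (1 + ε * (m + n))

/-- g(m,r) = −(m/2+r)(1+2εr)/(1+2ε(m+r)) -/
noncomputable def vg (ε m r : ℂ) : ℂ :=
  -(m / 2 + r) * (1 + 2 * ε * r) / (1 + 2 * ε * (m + r))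

/-- h(r,m) = −m(1+εm)/(1+2ε(m+r)) -/
noncomputable def vh (ε r m : ℂ) : ℂ := -m * (1 + ε * m) / (1 + 2 * ε * (m + r))

/-- d(r,s) = (1+2εs)/(1+ε(r+s)) -/
noncomputable def vd (ε r s : ℂ) : ℂ := (1 + 2 * ε * s) / (1 + ε * (r + s))

/-- integrality of a complex number -/
def IsZ (x : ℂ) : Prop := ∃ k : ℤ, x = (k : ℂ)

lemma IsZ.add {x y : ℂ} : IsZ x → IsZ y → IsZ (x + y) := by
  rintro ⟨a, rfl⟩ ⟨b, rfl⟩; exact ⟨a + b, by push_cast; ring⟩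
lemma IsZ.neg {x : ℂ} : IsZ x → IsZ (-x) := by
  rintro ⟨a, rfl⟩; exact ⟨-a, by push_cast; ring⟩
lemma IsZ.of_half {x y : ℂ} : InZHalf x → InZHalf y → IsZ (x + y) := by
  rintro ⟨a, rfl⟩ ⟨b, rfl⟩; exact ⟨a + b + 1, by push_cast; ring⟩
lemma InZHalf.neg {x : ℂ} : InZHalf x → InZHalf (-x) := by
  rintro ⟨a, rfl⟩; exact ⟨-a - 1, by push_cast; ring⟩
lemma InZHalf.add {x y : ℂ} : IsZ x → InZHalf y → InZHalf (x + y) := by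
  rintro ⟨a, rfl⟩ ⟨b, rfl⟩; exact ⟨a + b, by push_cast; ring⟩
lemma InZHalf.ne_zero {x : ℂ} : InZHalf x → x ≠ 0 := by
  rintro ⟨a, rfl⟩ h0
  have : (2 * a + 1 : ℂ) = 0 := by linear_combination 2 * h0
  have h2 : (2 * a + 1 : ℤ) = 0 := by exact_mod_cast this
  omega

lemma eps_nz (ε : ℂ)
    (hε : (0 < ε.re ∧ ∀ k : ℤ, ε⁻¹ ≠ (k : ℂ)) ∨ (ε.re = 0 ∧ 0 < ε.im))
    (x : ℂ) (hx : IsZ x) : 1 + ε * x ≠ 0 := by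
  obtain ⟨k, rfl⟩ := hx
  intro h0
  rcases hε with ⟨_, h⟩ | ⟨hr, hi⟩
  · apply h (-k)
    apply inv_eq_of_mul_eq_one_right
    push_cast
    linear_combination -h0
  · have := congrArg Complex.re h0
    simp [hr] at this

lemma vd_symm (ε r s : ℂ) (h : 1 + ε * (r + s) ≠ 0) : vd ε r s + vd ε s r = 2 := by
  have h' : 1 + ε * (s + r) ≠ 0 := by rwa [add_comm s r]
  unfold vd
  rw [add_comm s r]
  field_simp
  ring

/-- the candidate solution satisfies the `d`-equation -/
lemma v5 (ε m r s : ℂ) (a1 : 1 + ε * (m + r + s) ≠ 0) (a2 : 1 + ε * (r + s) ≠ 0)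
    (a3 : 1 + 2 * ε * (m + s) ≠ 0) :
    (m / 2 - r) * vd ε (m + r) s
      = vd ε r s * vf ε m (r + s) - vg ε m s * vd ε r (m + s) := by
  unfold vd vf vg
  have e1 : m + (r + s) = m + r + s := by ring
  have e2 : r + (m + s) = m + r + s := by ring
  rw [e1, e2]
  field_simp
  ring

theorem core (ε : ℂ) (nz : ∀ x, IsZ x → 1 + ε * x ≠ 0)
    (g h d : ℂ → ℂ → ℂ)
    (h1 : ∀ m r : ℂ, IsZ m → InZHalf r → g m r - h r m = m / 2 - r)
    (h2 : ∀ r s : ℂ, InZHalf r → InZHalf s → d r s + d s r = 2)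
    (h3 : ∀ m n r : ℂ, IsZ m → IsZ n → InZHalf r →
      (m - n) * g (m + n) r = g n r * g m (n + r) - g m r * g n (m + r))
    (h4 : ∀ m n r : ℂ, IsZ m → IsZ n → InZHalf r →
      (m / 2 - r) * h (m + r) n = h r n * g m (n + r) - vf ε m n * h r (m + n))
    (h5 : ∀ m r s : ℂ, IsZ m → InZHalf r → InZHalf s →
      (m / 2 - r) * d (m + r) s = d r s * vf ε m (r + s) - g m s * d r (m + s))
    (h6 : ∀ m r s : ℂ, IsZ m → InZHalf r → InZHalf s →
      2 * vf ε (r + s) m = h s m * d r (m + s) + h r m * d s (m + r))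
    (h7 : ∀ r s t : ℂ, InZHalf r → InZHalf s → InZHalf t →
      2 * g (r + s) t = d s t * h r (s + t) + d r t * h s (r + t)) :
    ∀ m r s : ℂ, IsZ m → InZHalf r → InZHalf s →
      g m r = vg ε m r ∧ h r m = vh ε r m ∧ d r s = vd ε r s := by
  have Z0 : IsZ 0 := ⟨0, by simp⟩
  have Z1 : IsZ 1 := ⟨1, by simp⟩
  have drr : ∀ r, InZHalf r → d r r = 1 := fun r hr => by
    linear_combination (1 / 2) * h2 r r hr hr
  have g0 : ∀ r, InZHalf r → g 0 r = -r := fun r hr => by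
    have := h5 0 r r Z0 hr hr
    simp only [zero_add, drr r hr] at this
    have e : vf ε 0 (r + r) = -(r + r) := by
      unfold vf
      have := nz (r + r) (IsZ.of_half hr hr)
      rw [zero_add, mul_div_assoc, div_self this, mul_one]
    rw [e] at this
    linear_combination this
  have h0 : ∀ r, InZHalf r → h r 0 = 0 := fun r hr => by
    have := h1 0 r Z0 hr
    rw [g0 r hr] at this
    linear_combination -this
  have B : ∀ m r, IsZ m → InZHalf r →
      h r m * d r (m + r) * (1 + ε * (2 * r + m)) = -m * (1 + ε * m) := fun m r hm hr => by
    have := h6 m r r hm hr hr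
    have n1 := nz (2 * r + m) (by rw [two_mul]; exact (IsZ.of_half hr hr).add hm)
    unfold vf at this
    rw [← two_mul r] at this
    field_simp at this
    linear_combination (-1 / 2) * this
  have dnz : ∀ r s, InZHalf r → InZHalf s → d r s ≠ 0 := fun r s hr hs h00 => by
    have hm : IsZ (s - r) := by rw [sub_eq_add_neg]; exact IsZ.of_half hs hr.neg
    have := B (s - r) r hm hr
    rw [sub_add_cancel, h00] at this
    have n1 := nz _ hm
    have : (s - r) * (1 + ε * (s - r)) = 0 := by linear_combination this
    rcases mul_eq_zero.1 this with h' | h'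
    · have : s = r := sub_eq_zero.1 h'
      subst this
      rw [drr s hs] at h00
      exact one_ne_zero h00
    · exact n1 h'
  have nz2 : ∀ r, InZHalf r → 1 + 2 * ε * r ≠ 0 := fun r hr => by
    have := nz _ (IsZ.of_half hr hr)
    convert this using 1; ring
  have G : ∀ m r, IsZ m → InZHalf r → d r (m + r) = vd ε r (m + r) →
      h r m = vh ε r m ∧ g m r = vg ε m r := fun m r hm hr hd => by
    have b := B m r hm hr
    have n1 := nz (r + (m + r)) (IsZ.of_half hr (InZHalf.add hm hr))
    have n2 := nz2 (m + r) (InZHalf.add hm hr)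
    have hh : h r m = vh ε r m := by
      rw [hd] at b
      unfold vd at b
      unfold vh
      have e : 2 * r + m = r + (m + r) := by ring
      rw [e] at b
      field_simp at b ⊢
      linear_combination b
    refine ⟨hh, ?_⟩
    have := h1 m r hm hr
    rw [hh] at this
    have : g m r = m / 2 - r + vh ε r m := by linear_combination this
    rw [this]
    unfold vg vh
    field_simp
    ring
  have G' : ∀ m r, IsZ m → InZHalf r → m ≠ 0 → h r m = vh ε r m →
      d r (m + r) = vd ε r (m + r) := fun m r hm hr hm0 hh => by
    have b := B m r hm hr
    have n1 := nz (r + (m + r)) (IsZ.of_half hr (InZHalf.add hm hr))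
    have n2 := nz2 (m + r) (InZHalf.add hm hr)
    have n3 := nz m hm
    have hh' : h r m * (1 + 2 * ε * (m + r)) = -m * (1 + ε * m) := by
      rw [hh]; exact div_mul_cancel₀ _ n2
    unfold vd
    have e : 2 * r + m = r + (m + r) := by ring
    rw [e] at b
    have : (m * (1 + ε * m)) * (d r (m + r) * (1 + ε * (r + (m + r))) - (1 + 2 * ε * (m + r))) = 0 := by
      linear_combination (-(1 + 2 * ε * (m + r))) * b
        + d r (m + r) * (1 + ε * (r + (m + r))) * hh'
    rcases mul_eq_zero.1 this with h' | h'
    · exact absurd h' (mul_ne_zero hm0 n3)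
    · rw [eq_div_iff n1]; linear_combination h'
  have S : ∀ r s, InZHalf r → InZHalf s → d r s = vd ε r s → d s r = vd ε s r :=
    fun r s hr hs hd => by
      have := h2 r s hr hs
      have := vd_symm ε r s (nz _ (IsZ.of_half hr hs))
      rw [← hd] at this
      linear_combination h2 r s hr hs - this
  have C : ∀ r, InZHalf r → g (2 * r) (-r) = 0 ∧ h (-r) (2 * r) = - (2 * r) ∧
      d (-r) r = 1 + 2 * ε * r := fun r hr => by
    have z2 : IsZ (2 * r) := by rw [two_mul]; exact IsZ.of_half hr hr
    have a := h7 r r (-r) hr hr hr.neg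
    rw [add_neg_cancel, h0 r hr, ← two_mul] at a
    have a1 : g (2 * r) (-r) = 0 := by linear_combination a / 2
    have a2 := h1 (2 * r) (-r) z2 hr.neg
    have a3 : h (-r) (2 * r) = - (2 * r) := by linear_combination a1 - a2
    refine ⟨a1, a3, ?_⟩
    have b := B (2 * r) (-r) z2 hr.neg
    rw [a3, show 2 * r + -r = r by ring] at b
    have hr0 := hr.ne_zero
    apply mul_left_cancel₀ (mul_ne_zero two_ne_zero hr0)
    linear_combination -b
  -- d(-r,3r) in terms of d(3r,r)
  have D : ∀ r, InZHalf r → d (-r) (3 * r) * d (3 * r) r * (1 + 4 * ε * r)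
      = 2 * d (3 * r) r * (1 + 4 * ε * r) - (1 - 2 * ε * r) := fun r hr => by
    have z2 : IsZ (2 * r) := by rw [two_mul]; exact IsZ.of_half hr hr
    have r3 : InZHalf (3 * r) := by
      rw [show 3 * r = 2 * r + r by ring]; exact InZHalf.add z2 hr
    have hr0 := hr.ne_zero
    have a := h7 (-r) (-r) (3 * r) hr.neg hr.neg r3
    have c := (C (-r) hr.neg).2.1
    have b := B (-(2 * r)) (3 * r) z2.neg r3
    have e := h1 (-(2 * r)) (3 * r) z2.neg r3
    rw [show -r + -r = -(2 * r) by ring, show -r + 3 * r = 2 * r by ring] at a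
    have c' : h (-r) (2 * r) = -(2 * r) := (C r hr).2.1
    rw [c'] at a
    rw [show -(2 * r) + 3 * r = r by ring] at b
    apply mul_left_cancel₀ (mul_ne_zero two_ne_zero hr0)
    linear_combination (1/2) * a * d (3 * r) r * (1 + 4 * ε * r)
      - e * d (3 * r) r * (1 + 4 * ε * r) - b
  have E : ∀ r, InZHalf r → d (3 * r) r = vd ε (3 * r) r := fun r hr => by
    have z2 : IsZ (2 * r) := by rw [two_mul]; exact IsZ.of_half hr hr
    have r3 : InZHalf (3 * r) := by
      rw [show 3 * r = 2 * r + r by ring]; exact InZHalf.add z2 hr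
    have hr0 := hr.ne_zero
    have n1 : 1 + 2 * ε * r ≠ 0 := nz2 r hr
    have n2 : 1 - 2 * ε * r ≠ 0 := by
      have := nz2 (-r) hr.neg
      convert this using 1; ring
    have n3 : 1 + 4 * ε * r ≠ 0 := by
      have := nz _ (z2.add z2)
      convert this using 1; ring
    have hp := dnz (3 * r) r r3 hr
    have hq := dnz (-r) (3 * r) hr.neg r3
    have hs := h2 (3 * r) r r3 hr
    have hp' := dnz r (3 * r) hr r3
    have dd := D r hr
    -- h3
    have a := h3 (2 * r) (-(2 * r)) r z2 z2.neg hr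
    rw [show 2 * r + -(2 * r) = 0 by ring, show -(2 * r) + r = -r by ring,
      show 2 * r + r = 3 * r by ring, (C r hr).1, g0 r hr] at a
    have a1 := h1 (2 * r) r z2 hr
    have a2 := h1 (-(2 * r)) (3 * r) z2.neg r3
    have b1 := B (2 * r) r z2 hr
    have b2 := B (-(2 * r)) (3 * r) z2.neg r3
    rw [show 2 * r + r = 3 * r by ring] at b1
    rw [show -(2 * r) + 3 * r = r by ring] at b2
    -- h7
    have c := h7 (-r) (3 * r) r hr.neg r3 hr
    rw [show -r + r = 0 by ring, h0 _ r3, show -r + 3 * r = 2 * r by ring,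
      show 3 * r + r = 4 * r by ring] at c
    have z4 : IsZ (4 * r) := by
      rw [show 4 * r = 2 * r + 2 * r by ring]; exact z2.add z2
    have b3 := B (4 * r) (-r) z4 hr.neg
    rw [show 4 * r + -r = 3 * r by ring] at b3
    have e1 : g (2 * r) r = h r (2 * r) := by linear_combination a1
    have e2 : g (-(2 * r)) (3 * r) = h (3 * r) (-(2 * r)) - 4 * r := by linear_combination a2
    rw [e1, e2] at a
    rw [e1] at c
    have hs' : d r (3 * r) = 2 - d (3 * r) r := by linear_combination hs
    rw [hs'] at b1 hp'
    generalize d (3 * r) r = p at *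
    generalize d (-r) (3 * r) = q at *
    generalize h r (2 * r) = X at *
    generalize h (3 * r) (-(2 * r)) = Y at *
    generalize h (-r) (4 * r) = W at *
    clear h1 h2 h3 h4 h5 h6 h7 G G' S C D B dnz drr g0 h0 nz nz2 a1 a2 e1 e2
    have quad : (p * (1 + 4 * ε * r) - 2 * ε * r - 1) * (p * (1 + 4 * ε * r) - 2 * ε * r + 1) = 0 := by
      apply mul_left_cancel₀ (mul_ne_zero (mul_ne_zero (show (4 : ℂ) ≠ 0 by norm_num) hr0) hr0)
      linear_combination ((2 - p) * (1 + 4 * ε * r) * p * (1 + 4 * ε * r)) * a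
        - b1 * (Y * p * (1 + 4 * ε * r) - 4 * r * p * (1 + 4 * ε * r))
        + 2 * r * (1 + 2 * ε * r) * b2
    rcases mul_eq_zero.1 quad with hP | hP
    · unfold vd
      have : 1 + ε * (3 * r + r) ≠ 0 := by convert n3 using 1; ring
      rw [eq_div_iff this]; linear_combination hP
    · exfalso
      have q3 : q = 3 := by
        apply mul_left_cancel₀ n2
        linear_combination -dd + (q - 2) * hP
      have X3 : 3 * X = -(2 * r) := by
        apply mul_left_cancel₀ n1
        linear_combination b1 + X * hP
      rw [q3] at b3
      have : 8 * r * (1 + 4 * ε * r) = 0 := by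
        linear_combination -(3 * (1 + 2 * ε * r) * (1 + 4 * ε * r)) * c
          + 2 * (1 + 2 * ε * r) * (1 + 4 * ε * r) * X3
          - p * (1 + 4 * ε * r) * b3 + 4 * r * (1 + 4 * ε * r) * hP
      exact mul_ne_zero (mul_ne_zero (by norm_num) hr0) n3 this
  have F : ∀ σ r, IsZ σ → σ ≠ 0 → InZHalf r → r ≠ σ / 2 → d r (-σ + r) = vd ε r (-σ + r) →
      d (σ + r) r = vd ε (σ + r) r := fun σ r hσ hσ0 hr hrσ hd => by
    have hr' := InZHalf.add hσ.neg hr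
    have hr'' := InZHalf.add hσ hr
    have a := h4 σ (-σ) r hσ hσ.neg hr
    rw [add_neg_cancel, h0 r hr, (G (-σ) r hσ.neg hr hd).1,
      (G σ (-σ + r) hσ hr' (by rw [add_neg_cancel_left]; exact S _ _ hr hr' hd)).2] at a
    have n1 := nz2 _ hr
    have n2 := nz2 _ hr'
    have key : (σ / 2 - r) * vh ε (σ + r) (-σ) = vh ε r (-σ) * vg ε σ (-σ + r) := by
      unfold vh vg
      rw [neg_add_cancel_left, add_neg_cancel_left]
      field_simp
      ring
    have hh : h (σ + r) (-σ) = vh ε (σ + r) (-σ) := by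
      apply mul_left_cancel₀ (sub_ne_zero.2 hrσ.symm)
      rw [key, a]; ring
    have := G' (-σ) (σ + r) hσ.neg hr'' (neg_ne_zero.2 hσ0) hh
    rwa [neg_add_cancel_left] at this
  have I : ∀ σ : ℂ, (σ = 1 ∨ σ = -1) → ∀ k : ℕ,
      d (σ * (k + 3 / 2)) (σ * (k + 1 / 2)) = vd ε (σ * (k + 3 / 2)) (σ * (k + 1 / 2)) := by
    intro σ hσ k
    have zσ : IsZ σ := by
      rcases hσ with rfl | rfl
      · exact Z1
      · exact Z1.neg
    have σ0 : σ ≠ 0 := by rcases hσ with rfl | rfl <;> norm_num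
    have hH : ∀ k : ℕ, InZHalf (σ * (k + 1 / 2)) := by
      intro k
      rcases hσ with rfl | rfl
      · exact ⟨k, by push_cast; ring⟩
      · exact ⟨-k - 1, by push_cast; ring⟩
    induction k with
    | zero =>
      have := E (σ * ((0 : ℕ) + 1 / 2)) (hH 0)
      convert this using 2 <;> push_cast <;> ring
    | succ k ih =>
      have e1 : σ * ((k : ℂ) + 1 / 2) = -σ + σ * (((k + 1 : ℕ) : ℂ) + 1 / 2) := by push_cast; ring
      have e2 : σ * ((k : ℂ) + 3 / 2) = σ * (((k + 1 : ℕ) : ℂ) + 1 / 2) := by push_cast; ring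
      rw [e1, e2] at ih
      have := F σ _ zσ σ0 (hH (k + 1)) (by
        intro hc
        have : σ * ((k + 1 : ℕ) : ℂ) = 0 := by linear_combination hc
        exact mul_ne_zero σ0 (Nat.cast_ne_zero.2 (Nat.succ_ne_zero k)) this) ih
      rwa [show σ + σ * (((k + 1 : ℕ) : ℂ) + 1 / 2) = σ * (((k + 1 : ℕ) : ℂ) + 3 / 2) by ring] at this
  have A : ∀ r, InZHalf r → d r (r + 1) = vd ε r (r + 1) := by
    rintro r ⟨j, rfl⟩
    have hj : InZHalf ((j : ℂ) + 1 / 2) := ⟨j, rfl⟩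
    have hj1 : InZHalf ((j : ℂ) + 1 / 2 + 1) := ⟨j + 1, by push_cast; ring⟩
    rcases lt_trichotomy j (-1) with hlt | heq | hgt
    · obtain ⟨k, hk⟩ := Int.eq_ofNat_of_zero_le (show 0 ≤ -j - 2 by omega)
      have hjk : j = -(k : ℤ) - 2 := by omega
      have := I (-1) (Or.inr rfl) k
      rw [hjk]
      convert this using 2 <;> push_cast <;> ring
    · subst heq
      have := (C (1 / 2) ⟨0, by simp⟩).2.2
      have e1 : ((-1 : ℤ) : ℂ) + 1 / 2 = -(1 / 2) := by push_cast; ring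
      rw [e1, show -(1 / 2 : ℂ) + 1 = 1 / 2 by ring, this]
      unfold vd
      rw [neg_add_cancel]; simp
    · obtain ⟨k, hk⟩ := Int.eq_ofNat_of_zero_le (show 0 ≤ j by omega)
      apply S _ _ hj1 hj
      have := I 1 (Or.inl rfl) k
      rw [hk]
      convert this using 2 <;> push_cast <;> ring
  have M : ∀ K : ℕ, (∀ r, InZHalf r → d r (r + K) = vd ε r (r + K)) ∧
      (∀ r, InZHalf r → d r (r + K + 1) = vd ε r (r + K + 1)) := by
    intro K
    induction K with
    | zero =>
      refine ⟨fun r hr => ?_, fun r hr => ?_⟩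
      · have n := nz _ (IsZ.of_half hr hr)
        rw [Nat.cast_zero, add_zero, drr r hr]
        unfold vd
        rw [eq_div_iff n]; ring
      · have := A r hr
        simpa using this
    | succ K ih =>
      obtain ⟨ih0, ih1⟩ := ih
      have ih1' : ∀ r, InZHalf r → d r (r + (K + 1 : ℕ)) = vd ε r (r + (K + 1 : ℕ)) := by
        intro r hr
        have := ih1 r hr
        rwa [show r + (K : ℂ) + 1 = r + (K + 1 : ℕ) by push_cast; ring] at this
      refine ⟨ih1', fun r hr => ?_⟩
      have ZK : IsZ (K : ℂ) := ⟨K, by simp⟩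
      have hr1 : InZHalf (r + 1) := by rw [add_comm]; exact InZHalf.add Z1 hr
      have hs : InZHalf (r + K + 1) := by
        rw [show r + (K : ℂ) + 1 = (K + 1) + r by ring]; exact InZHalf.add (ZK.add Z1) hr
      have hs2 : InZHalf (1 + (r + K + 1)) := InZHalf.add Z1 hs
      rw [show r + ((K + 1 : ℕ) : ℂ) + 1 = 1 + (r + K + 1) by push_cast; ring]
      have d1 : d (1 + r) (r + K + 1) = vd ε (1 + r) (r + K + 1) := by
        have := ih0 (r + 1) hr1
        rw [show r + 1 + (K : ℂ) = r + K + 1 by ring] at this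
        rwa [add_comm 1 r]
      by_cases hr3 : r = -3 / 2
      · by_cases hK : K = 0
        · subst hK
          have dd := D (-1 / 2) ⟨-1, by push_cast; ring⟩
          have e := E (-1 / 2) ⟨-1, by push_cast; ring⟩
          rw [e] at dd
          have n1 := nz (-1) Z1.neg
          have n2 := nz (-2) ⟨-2, by push_cast; ring⟩
          have hh : InZHalf (1 / 2) := ⟨0, by simp⟩
          subst hr3
          rw [show (1 + (-3 / 2 + ((0 : ℕ) : ℂ) + 1)) = 1 / 2 by push_cast; ring]
          apply S _ _ hh hr
          rw [show -(-1 / 2 : ℂ) = 1 / 2 by ring, show (3 * (-1 / 2) : ℂ) = -3 / 2 by ring] at dd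
          generalize d (1 / 2) (-3 / 2) = q at *
          unfold vd at dd ⊢
          have n2' : 1 + ε * (-3 / 2 + -1 / 2) ≠ 0 := by convert n2 using 2; ring
          have n1' : 1 + ε * (1 / 2 + -3 / 2) ≠ 0 := by convert n1 using 2; ring
          rw [eq_div_iff n1']
          have k : (1 + 2 * ε * (-1 / 2)) / (1 + ε * (-3 / 2 + -1 / 2)) * (1 + 4 * ε * (-1 / 2))
              = 1 + 2 * ε * (-1 / 2) := by
            rw [div_mul_eq_mul_div, div_eq_iff n2']; ring
          linear_combination dd - (q - 2) * k
        · have a := h5 1 r (r + K + 1) Z1 hr hs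
          have v := v5 ε 1 r (r + K + 1)
            (nz _ (by rw [add_comm 1 r]; exact IsZ.of_half hr1 hs))
            (nz _ (IsZ.of_half hr hs)) (nz2 _ hs2)
          have dg := (G 1 (r + K + 1) Z1 hs (by
            have := A _ hs
            rwa [add_comm (r + (K : ℂ) + 1) (1 : ℂ)] at this)).2
          rw [d1, ih1 r hr, dg, v] at a
          have gn : vg ε 1 (r + K + 1) ≠ 0 := by
            unfold vg
            refine div_ne_zero (mul_ne_zero (neg_ne_zero.2 ?_) (nz2 _ hs)) (nz2 _ hs2)
            rw [hr3, show (1 / 2 + (-3 / 2 + (K : ℂ) + 1)) = K by ring]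
            exact Nat.cast_ne_zero.2 hK
          apply mul_left_cancel₀ gn
          linear_combination a
      · have a := h5 (-1) (1 + r) (1 + (r + K + 1)) Z1.neg (InZHalf.add Z1 hr) hs2
        have v := v5 ε (-1) (1 + r) (1 + (r + K + 1))
          (nz _ (by rw [neg_add_cancel_left]; exact IsZ.of_half hr hs2))
          (nz _ (IsZ.of_half (InZHalf.add Z1 hr) hs2))
          (nz2 _ (by rw [neg_add_cancel_left]; exact hs))
        have dg := (G (-1) (1 + (r + K + 1)) Z1.neg hs2 (by
            have := S _ _ hs (by rw [add_comm]; exact hs2) (A _ hs)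
            rw [neg_add_cancel_left]
            rwa [add_comm (r + (K : ℂ) + 1) (1 : ℂ)] at this)).2
        have d2 : d (1 + r) (1 + (r + K + 1)) = vd ε (1 + r) (1 + (r + K + 1)) := by
          have := ih1 (r + 1) hr1
          rwa [show r + 1 + (K : ℂ) + 1 = 1 + (r + K + 1) by ring, add_comm r 1] at this
        rw [neg_add_cancel_left, neg_add_cancel_left] at a v
        rw [d1, d2, dg, ← v] at a
        refine mul_left_cancel₀ ?_ a
        intro hc
        exact hr3 (by linear_combination -hc)
  have Dall : ∀ r s, InZHalf r → InZHalf s → d r s = vd ε r s := by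
    intro r s hr hs
    obtain ⟨a, rfl⟩ := hr
    obtain ⟨b, rfl⟩ := hs
    rcases le_total a b with hab | hab
    · obtain ⟨k, hk⟩ := Int.eq_ofNat_of_zero_le (sub_nonneg.2 hab)
      have := (M k).1 (a + 1 / 2) ⟨a, rfl⟩
      have hb : b = a + k := by omega
      rw [hb]
      convert this using 2 <;> push_cast <;> ring
    · obtain ⟨k, hk⟩ := Int.eq_ofNat_of_zero_le (sub_nonneg.2 hab)
      have := (M k).1 (b + 1 / 2) ⟨b, rfl⟩
      have hb : a = b + k := by omega
      apply S _ _ ⟨b, rfl⟩ ⟨a, rfl⟩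
      rw [hb]
      convert this using 2 <;> push_cast <;> ring
  intro m r s hm hr hs
  have := G m r hm hr (Dall _ _ hr (InZHalf.add hm hr))
  exact ⟨this.2, this.1, Dall r s hr hs⟩

/-- uniqueness part of Theorem 3.2 in the Neveu–Schwarz case θ = 1/2:
any solution (g,h,d) of equations (3.2)–(3.3) with f given by (3.4) is the one of
equation (3.5). -/
theorem super_virasoro_uniqueness_NS (ε : ℂ)
    (hε : (0 < ε.re ∧ ∀ k : ℤ, ε⁻¹ ≠ (k : ℂ)) ∨ (ε.re = 0 ∧ 0 < ε.im))
    (g h d : ℂ → ℂ → ℂ)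
    (h1 : ∀ (m : ℤ) (r : ℂ), InZHalf r → g m r - h r m = (m : ℂ) / 2 - r)
    (h2 : ∀ r s : ℂ, InZHalf r → InZHalf s → d r s + d s r = 2)
    (h3 : ∀ (m n : ℤ) (r : ℂ), InZHalf r →
      ((m : ℂ) - (n : ℂ)) * g ((m : ℂ) + (n : ℂ)) r
        = g n r * g m ((n : ℂ) + r) - g m r * g n ((m : ℂ) + r))
    (h4 : ∀ (m n : ℤ) (r : ℂ), InZHalf r →
      ((m : ℂ) / 2 - r) * h ((m : ℂ) + r) n
        = h r n * g m ((n : ℂ) + r) - vf ε m n * h r ((m : ℂ) + (n : ℂ)))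
    (h5 : ∀ (m : ℤ) (r s : ℂ), InZHalf r → InZHalf s →
      ((m : ℂ) / 2 - r) * d ((m : ℂ) + r) s
        = d r s * vf ε m (r + s) - g m s * d r ((m : ℂ) + s))
    (h6 : ∀ (m : ℤ) (r s : ℂ), InZHalf r → InZHalf s →
      2 * vf ε (r + s) m
        = h s m * d r ((m : ℂ) + s) + h r m * d s ((m : ℂ) + r))
    (h7 : ∀ r s t : ℂ, InZHalf r → InZHalf s → InZHalf t →
      2 * g (r + s) t = d s t * h r (s + t) + d r t * h s (r + t)) :
    ∀ (m : ℤ) (r s : ℂ), InZHalf r → InZHalf s →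
      g m r = vg ε m r ∧ h r m = vh ε r m ∧ d r s = vd ε r s := by
  intro m r s hr hs
  refine core ε (eps_nz ε hε) g h d ?_ h2 ?_ ?_ ?_ ?_ h7 m r s ⟨m, rfl⟩ hr hs
  · rintro _ r ⟨m, rfl⟩ hr; exact h1 m r hr
  · rintro _ _ r ⟨m, rfl⟩ ⟨n, rfl⟩ hr; exact h3 m n r hr
  · rintro _ _ r ⟨m, rfl⟩ ⟨n, rfl⟩ hr; exact h4 m n r hr
  · rintro _ r s ⟨m, rfl⟩ hr hs; exact h5 m r s hr hs
  · rintro _ r s ⟨m, rfl⟩ hr hs; exact h6 m r s hr hs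
end

section
/- Let θ ∈ {0,1/2} and let ε ∈ ℂ with 1+εk ≠ 0 for every integer k. Suppose G: ℤ×(ℤ+θ) → ℂ, H: (ℤ+θ)×ℤ → ℂ, D: (ℤ+θ)×(ℤ+θ) → ℂ satisfy, for all m,n ∈ ℤ and r,s,t ∈ ℤ+θ: G(m,r)(1+2εr) − H(r,m)(1+εm) = (m/2−r)(1+2ε(m+r)); D(r,s)(1+2εs) + D(s,r)(1+2εr) = 2+2ε(r+s); (m−n)G(m+n,r) = G(n,r)G(m,n+r) − G(m,r)G(n,m+r); (m/2−r)H(m+r,n) = H(r,n)G(m,n+r) + n·H(r,m+n); (m/2−r)D(m+r,s) = −(r+s)D(r,s) − G(m,s)D(r,m+s); −2m = H(s,m)D(r,m+s) + H(r,m)D(s,m+r); 2G(r+s,t) = D(s,t)H(r,s+t) + D(r,t)H(s,r+t). Then G(2s,t) = −s−t and H(t,2s) = −2s for all s,t ∈ ℤ+θ. -/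
/-- membership in ℤ + θ -/
def InZT (θ x : ℂ) : Prop := ∃ k : ℤ, x = (k : ℂ) + θ

structure SysGHD (θ ε : ℂ) (G H D : ℂ → ℂ → ℂ) : Prop where
  hθ : θ = 0 ∨ θ = 1 / 2
  hε : ∀ k : ℤ, 1 + ε * (k : ℂ) ≠ 0
  e1 : ∀ (m : ℤ) (r : ℂ), InZT θ r →
      G m r * (1 + 2 * ε * r) - H r m * (1 + ε * (m : ℂ))
        = ((m : ℂ) / 2 - r) * (1 + 2 * ε * ((m : ℂ) + r))
  e2 : ∀ r s : ℂ, InZT θ r → InZT θ s →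
      D r s * (1 + 2 * ε * s) + D s r * (1 + 2 * ε * r) = 2 + 2 * ε * (r + s)
  e3 : ∀ (m n : ℤ) (r : ℂ), InZT θ r →
      ((m : ℂ) - (n : ℂ)) * G ((m : ℂ) + (n : ℂ)) r
        = G n r * G m ((n : ℂ) + r) - G m r * G n ((m : ℂ) + r)
  e5 : ∀ (m : ℤ) (r s : ℂ), InZT θ r → InZT θ s →
      ((m : ℂ) / 2 - r) * D ((m : ℂ) + r) s
        = -(r + s) * D r s - G m s * D r ((m : ℂ) + s)
  e6 : ∀ (m : ℤ) (r s : ℂ), InZT θ r → InZT θ s →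
      -2 * (m : ℂ) = H s m * D r ((m : ℂ) + s) + H r m * D s ((m : ℂ) + r)
  e7 : ∀ r s t : ℂ, InZT θ r → InZT θ s → InZT θ t →
      2 * G (r + s) t = D s t * H r (s + t) + D r t * H s (r + t)

namespace SysGHD

variable {θ ε : ℂ} {G H D : ℂ → ℂ → ℂ}

lemma two_mul (S : SysGHD θ ε G H D) : ∃ k : ℤ, 2 * θ = k := by
  rcases S.hθ with h | h
  · exact ⟨0, by simp [h]⟩
  · exact ⟨1, by simp [h]⟩

lemma two_mem (S : SysGHD θ ε G H D) {r : ℂ} (hr : InZT θ r) : ∃ k : ℤ, (k : ℂ) = 2 * r := by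
  obtain ⟨k, hk⟩ := S.two_mul
  obtain ⟨j, hj⟩ := hr
  exact ⟨2 * j + k, by push_cast; rw [← hk, hj]; ring⟩

lemma sub_mem {r s : ℂ} (hr : InZT θ r) (hs : InZT θ s) : ∃ k : ℤ, (k : ℂ) = r - s := by
  obtain ⟨i, hi⟩ := hs
  obtain ⟨j, hj⟩ := hr
  exact ⟨j - i, by push_cast; rw [hi, hj]; ring⟩

lemma add_mem {r : ℂ} (hr : InZT θ r) (k : ℤ) : InZT θ (k + r) := by
  obtain ⟨j, hj⟩ := hr
  exact ⟨k + j, by push_cast; rw [hj]; ring⟩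

lemma neg_mem (S : SysGHD θ ε G H D) {r : ℂ} (hr : InZT θ r) : InZT θ (-r) := by
  obtain ⟨k, hk⟩ := S.two_mem hr
  have := add_mem hr (-k)
  have h : (((-k : ℤ) : ℂ) + r) = -r := by push_cast; rw [hk]; ring
  rwa [h] at this

lemma ne (S : SysGHD θ ε G H D) {r : ℂ} (hr : InZT θ r) : 1 + 2 * ε * r ≠ 0 := by
  obtain ⟨k, hk⟩ := S.two_mem hr
  have := S.hε k
  rw [hk] at this
  intro h
  apply this
  linear_combination h

lemma Drr (S : SysGHD θ ε G H D) {r : ℂ} (hr : InZT θ r) : D r r = 1 := by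
  have h := S.e2 r r hr hr
  apply mul_right_cancel₀ (S.ne hr)
  linear_combination h / 2

lemma HD (S : SysGHD θ ε G H D) {r : ℂ} (hr : InZT θ r) (m : ℤ) :
    H r m * D r (m + r) = -m := by
  have h := S.e6 m r r hr hr
  linear_combination -h / 2

lemma H0 (S : SysGHD θ ε G H D) {r : ℂ} (hr : InZT θ r) : H r 0 = 0 := by
  have h := S.HD hr 0
  simpa [S.Drr hr] using h

lemma G0 (S : SysGHD θ ε G H D) {r : ℂ} (hr : InZT θ r) : G 0 r = -r := by
  have h := S.e1 0 r hr
  apply mul_right_cancel₀ (S.ne hr)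
  simp [S.H0 hr] at h
  linear_combination h

lemma Dne (S : SysGHD θ ε G H D) {r s : ℂ} (hr : InZT θ r) (hs : InZT θ s) : D r s ≠ 0 := by
  by_cases h : r = s
  · subst h
    rw [S.Drr hr]
    exact one_ne_zero
  · obtain ⟨k, hk⟩ := sub_mem hs hr
    have h1 := S.HD hr k
    rw [hk] at h1
    intro h2
    rw [sub_add_cancel, h2, mul_zero] at h1
    apply h
    linear_combination -h1

lemma Hneg (S : SysGHD θ ε G H D) {s : ℂ} (hs : InZT θ s) : H (-s) (2 * s) = -2 * s := by
  have h := S.e7 (-s) s s (S.neg_mem hs) hs hs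
  rw [neg_add_cancel, S.G0 hs, S.Drr hs, S.H0 hs, ← _root_.two_mul s] at h
  linear_combination -h

lemma Dneg (S : SysGHD θ ε G H D) {s : ℂ} (hs : InZT θ s) : D (-s) s = 1 := by
  by_cases h0 : s = 0
  · subst h0
    rw [neg_zero]
    exact S.Drr hs
  obtain ⟨k, hk⟩ := S.two_mem hs
  have h := S.HD (S.neg_mem hs) k
  rw [hk, S.Hneg hs, show 2 * s + -s = s by ring] at h
  have h2 : -2 * s ≠ 0 := by simp [h0]
  apply mul_left_cancel₀ h2
  linear_combination h

lemma Dneg' (S : SysGHD θ ε G H D) {s : ℂ} (hs : InZT θ s) : D s (-s) = 1 := by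
  have := S.Dneg (S.neg_mem hs)
  rwa [neg_neg] at this

lemma Gd (S : SysGHD θ ε G H D) {s t : ℂ} (hs : InZT θ s) (ht : InZT θ t) :
    G (2 * s) t * D s (2 * s + t) = -(s + t) * D s t := by
  obtain ⟨k, hk⟩ := S.two_mem hs
  have h := S.e5 k s t hs ht
  rw [hk] at h
  linear_combination h

lemma anti (S : SysGHD θ ε G H D) {r : ℂ} (hr : InZT θ r) (n : ℤ) :
    H r n + H (-n - r) n = -2 * n := by
  have hs : InZT θ (-n - r) := by
    have := S.neg_mem (add_mem hr n)
    rwa [neg_add'] at this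
  have h := S.e6 n r (-n - r) hr hs
  rw [show (n : ℂ) + (-n - r) = -r by ring, S.Dneg' hr] at h
  have h2 := S.Dneg hs
  have h3 := S.Dneg' hs
  rw [show -(-(n : ℂ) - r) = n + r by ring] at h3
  rw [h3] at h
  linear_combination -h

/-- recursion for the quotient D(a,.)/D(-a,.) -/
lemma frec (S : SysGHD θ ε G H D) {a : ℂ} (ha : InZT θ a) (m : ℤ) (hm : m ≠ 0) :
    D a (m - a) * D a (m + a) + D (-a) (m + a) * D (-a) (m - a)
      = 2 * D a (m + a) * D (-a) (m - a) := by
  have h := S.e6 m a (-a) ha (S.neg_mem ha)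
  have h1 := S.HD ha m
  have h2 := S.HD (S.neg_mem ha) m
  rw [← sub_eq_add_neg] at h h2
  have hm' : (m : ℂ) ≠ 0 := by exact_mod_cast hm
  apply mul_left_cancel₀ hm'
  linear_combination D a (m + a) * D (-a) (m - a) * h + D a (m - a) * D a (m + a) * h2 + D (-a) (m + a) * D (-a) (m - a) * h1

lemma fiff (S : SysGHD θ ε G H D) {a : ℂ} (ha : InZT θ a) (m : ℤ) (hm : m ≠ 0) :
    D a (m - a) = D (-a) (m - a) ↔ D a (m + a) = D (-a) (m + a) := by
  have h := S.frec ha m hm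
  have n1 := S.Dne ha (add_mem ha m)
  have n2 := S.Dne (S.neg_mem ha) (add_mem (S.neg_mem ha) m)
  rw [← sub_eq_add_neg] at n2
  constructor
  · intro h1
    rw [h1] at h
    apply mul_left_cancel₀ n2
    linear_combination -h
  · intro h1
    rw [h1] at h n1
    apply mul_left_cancel₀ n1
    linear_combination h

end SysGHD

lemma coreAlg {a t ε g g' p p' h h' k k' d d' c c' ρ σ : ℂ} (hε1 : 1 + 2 * a * ε ≠ 0)
    (hε2 : 1 - 2 * a * ε ≠ 0) (ha : a ≠ 0) (hta : t + a ≠ 0)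
    (hA : 1 + 2 * ε * t ≠ 0) (hB : 1 + 2 * ε * (-2 * a - t) ≠ 0)
    (hC : 1 + 2 * ε * (2 * a + t) ≠ 0) (hE : 1 + 2 * ε * (-t) ≠ 0)
    (_hρ : ρ ≠ 0) (_hσ : σ ≠ 0)
    (hg : g = -(a + t) * ρ) (hp : p * ρ = -(a + t))
    (hg' : g' = (a + t) * σ) (hp' : p' * σ = (a + t))
    (h1 : g * (1 + 2 * ε * t) - h * (1 + 2 * a * ε) = (a - t) * (1 + 2 * ε * (2 * a + t)))
    (h2 : p * (1 + 2 * ε * (2 * a + t)) - k * (1 - 2 * a * ε) = (-3 * a - t) * (1 + 2 * ε * t))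
    (h3 : g' * (1 + 2 * ε * (-2 * a - t)) - h' * (1 + 2 * a * ε) = (3 * a + t) * (1 + 2 * ε * (-t)))
    (h4 : p' * (1 + 2 * ε * (-t)) - k' * (1 - 2 * a * ε) = (t - a) * (1 + 2 * ε * (-2 * a - t)))
    (hh : h + h' = -4 * a) (kk : k + k' = 4 * a)
    (d1 : h * d = -2 * a) (d2 : k * c = 2 * a)
    (d3 : h' * d' = -2 * a) (d4 : k' * c' = 2 * a)
    (e : d * (1 + 2 * ε * (2 * a + t)) + c * (1 + 2 * ε * t) = 2 + 2 * ε * (2 * t + 2 * a))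
    (e' : d' * (1 + 2 * ε * (-t)) + c' * (1 + 2 * ε * (-2 * a - t)) = 2 + 2 * ε * (-2 * t - 2 * a)) :
    ρ = 1 := by
  by_contra hne
  have r1 : (1 - ρ) * (1 + 2 * ε * t) = (1 - σ) * (1 + 2 * ε * (-2 * a - t)) := by
    apply mul_left_cancel₀ hta
    subst hg hg'
    linear_combination h1 + h3 + (1 + 2 * a * ε) * hh
  have r2 : (ρ - 1) * σ * (1 + 2 * ε * (2 * a + t)) = (σ - 1) * ρ * (1 + 2 * ε * (-t)) := by
    apply mul_left_cancel₀ hta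
    linear_combination ρ * σ * (h2 + h4 + (1 - 2 * a * ε) * kk) - σ * (1 + 2 * ε * (2 * a + t)) * hp - ρ * (1 + 2 * ε * (-t)) * hp'
  have hρ1 : ρ - 1 ≠ 0 := sub_ne_zero.mpr hne
  by_cases hz : ε = 0
  · subst hz
    have hs : σ = ρ := by linear_combination r1
    subst hs
    have hh0 : h = -(a + t) * σ - (a - t) := by linear_combination hg - h1
    have k0 : k * σ = -(a + t) + (3 * a + t) * σ := by linear_combination hp - σ * h2
    have hh1 : h' = (a + t) * σ - (3 * a + t) := by linear_combination hg' - h3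
    have k1 : k' * σ = (a + t) - (t - a) * σ := by linear_combination hp' - σ * h4
    have w : h * k = a * (h - k) := by
      linear_combination -(h * k / 2) * e + (k / 2) * d1 + (h / 2) * d2
    have w' : h' * k' = a * (h' - k') := by
      linear_combination -(h' * k' / 2) * e' + (k' / 2) * d3 + (h' / 2) * d4
    have q1 : σ * (t + 2 * a) = t := by
      apply mul_left_cancel₀ hρ1
      apply mul_left_cancel₀ hta
      subst hh0
      linear_combination -σ * w + (-(a + t) * σ - (a - t) + a) * k0
    have q2 : σ * (-t) = -2 * a - t := by
      apply mul_left_cancel₀ hρ1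
      apply mul_left_cancel₀ hta
      subst hh1
      linear_combination σ * w' - ((a + t) * σ - (3 * a + t) + a) * k1
    have : (σ - 1) * (t + a) = 0 := by
      linear_combination (q1 - q2) / 2
    exact (mul_ne_zero hρ1 hta) this
  · have r4 : σ * (1 + 2 * ε * (2 * a + t)) * (1 + 2 * ε * (-2 * a - t))
        = ρ * (1 + 2 * ε * t) * (1 + 2 * ε * (-t)) := by
      apply mul_left_cancel₀ hρ1
      linear_combination (1 + 2 * ε * (-2 * a - t)) * r2 + ρ * (1 + 2 * ε * (-t)) * r1
    have r3 : ρ * (1 + 2 * ε * t) = 1 + 2 * ε * (2 * a + t) := by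
      apply mul_left_cancel₀ (mul_ne_zero (mul_ne_zero (by norm_num : (4 : ℂ) ≠ 0) hz) hta)
      linear_combination r4 - (1 + 2 * ε * (2 * a + t)) * r1
    have s1 : d * (1 + 2 * ε * (2 * a + t)) = 1 + 2 * a * ε := by
      apply mul_left_cancel₀ ha
      subst hg
      linear_combination (-1/2 : ℂ) * (d1 * (1 + 2 * a * ε) + d * h1 + d * (a + t) * r3)
    have s2 : c * (1 + 2 * ε * t) = 1 - 2 * a * ε := by
      apply mul_left_cancel₀ ha
      linear_combination (1/2 : ℂ) * (d2 * (1 - 2 * a * ε) + c * h2 + c * p * r3 - c * (1 + 2 * ε * t) * hp)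
    have : ε * (t + a) = 0 := by linear_combination (s1 + s2 - e) / 4
    exact (mul_ne_zero hz hta) this

/-- odd lattice -/
lemma oddLattice (E : ℤ → ℤ → ℂ)
    (h1 : ∀ i j : ℤ, -(i : ℂ) * E (i + 1) j = -(i + j + 1) * E i j + (j + 1) * E i (j + 1))
    (h2 : ∀ i j : ℤ, -((i : ℂ) + 1) * E (i - 1) j = -(i + j + 1) * E i j + j * E i (j - 1))
    (h0 : ∀ j, E 0 j = 1) (h0' : ∀ j, E (-1) j = 1) (hd : ∀ i, E i (-1 - i) = 1) :
    ∀ i j, E i j = 1 := by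
  have up : ∀ i : ℤ, 0 ≤ i → ∀ j, E i j = 1 := by
    intro i hi
    induction i, hi using Int.leInduction with
    | base => exact h0
    | succ i hi ih =>
      have key : ∀ j : ℤ, ((i : ℂ) + j + 2) * (E (i + 1) j - 1) = j * (E (i + 1) (j - 1) - 1) := by
        intro j
        have := h2 (i + 1) j
        rw [add_sub_cancel_right, ih] at this
        push_cast at this
        linear_combination this
      have hdi := hd (i + 1)
      intro j
      rcases le_total (-1 - (i + 1)) j with hj | hj
      · induction j, hj using Int.leInduction with
        | base => exact hdi
        | succ j hj ihj =>
          have := key (j + 1)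
          rw [add_sub_cancel_right, ihj, sub_self, mul_zero] at this
          rcases mul_eq_zero.mp this with h | h
          · exfalso
            have h' : i + (j + 1) + 2 = 0 := by exact_mod_cast h
            omega
          · linear_combination h
      · induction j, hj using Int.leInductionDown with
        | base => exact hdi
        | pred j hj ihj =>
          have := key j
          rw [ihj, sub_self, mul_zero] at this
          rcases mul_eq_zero.mp this.symm with h | h
          · exfalso
            have h' : j = 0 := by exact_mod_cast h
            omega
          · linear_combination h
  have down : ∀ i : ℤ, i ≤ -1 → ∀ j, E i j = 1 := by
    intro i hi
    induction i, hi using Int.leInductionDown with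
    | base => exact h0'
    | pred i hi ih =>
      have key : ∀ j : ℤ, ((i : ℂ) + j) * (E (i - 1) j - 1) = (j + 1) * (E (i - 1) (j + 1) - 1) := by
        intro j
        have := h1 (i - 1) j
        rw [sub_add_cancel, ih] at this
        push_cast at this
        linear_combination this
      have hdi := hd (i - 1)
      intro j
      rcases le_total (-1 - (i - 1)) j with hj | hj
      · induction j, hj using Int.leInduction with
        | base => exact hdi
        | succ j hj ihj =>
          have := key j
          rw [ihj, sub_self, mul_zero] at this
          rcases mul_eq_zero.mp this.symm with h | h
          · exfalso
            have h' : j + 1 = 0 := by exact_mod_cast h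
            omega
          · linear_combination h
      · induction j, hj using Int.leInductionDown with
        | base => exact hdi
        | pred j hj ihj =>
          have := key (j - 1)
          rw [sub_add_cancel, ihj, sub_self, mul_zero] at this
          rcases mul_eq_zero.mp this with h | h
          · exfalso
            have h' : i + (j - 1) = 0 := by exact_mod_cast h
            omega
          · linear_combination h
  intro i j
  rcases le_total 0 i with h | h
  · exact up i h j
  · rcases eq_or_lt_of_le h with h | h
    · rw [h, h0]
    · exact down i (by omega) j

/-- even lattice -/
lemma evenLattice (E : ℤ → ℤ → ℂ)
    (h1 : ∀ i j : ℤ, (1 - 2 * i : ℂ) * E (i + 1) j = -(2 * i + 2 * j) * E i j + (1 + 2 * j) * E i (j + 1))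
    (h2 : ∀ i j : ℤ, (1 + 2 * i : ℂ) * E (i - 1) j = (2 * i + 2 * j) * E i j - (2 * j - 1) * E i (j - 1))
    (h0 : E 0 0 = 1) (hp : E 0 1 = 1) (hm : E 0 (-1) = 1) :
    ∀ i j, E i j = 1 := by
  have a1 : ∀ j : ℤ, E 1 j = -(2 * j) * E 0 j + (1 + 2 * j) * E 0 (j + 1) := by
    intro j
    simpa using h1 0 j
  have hrec : ∀ j : ℤ, (2 * j + 1 : ℂ) * (2 * j + 2) * (E 0 (j + 1) - 1)
      = (8 * j ^ 2 + 4) * (E 0 j - 1) - (2 * j - 1) * (2 * j - 2) * (E 0 (j - 1) - 1) := by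
    intro j
    have h := h2 1 j
    have b := a1 j
    have b' := a1 (j - 1)
    rw [b, b', sub_add_cancel, sub_self] at h
    push_cast at h
    linear_combination -h
  have row : ∀ j, E 0 j = 1 := by
    have u : ∀ j : ℤ, 0 ≤ j → E 0 j = 1 ∧ E 0 (j + 1) = 1 := by
      intro j hj
      induction j, hj using Int.leInduction with
      | base => exact ⟨h0, by simpa using hp⟩
      | succ j hj ih =>
        refine ⟨ih.2, ?_⟩
        have := hrec (j + 1)
        rw [add_sub_cancel_right, ih.1, ih.2, sub_self, mul_zero, mul_zero, sub_zero, mul_eq_zero, mul_eq_zero] at this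
        rcases this with (h | h) | h
        · exfalso
          have h' : 2 * (j + 1) + 1 = 0 := by exact_mod_cast h
          omega
        · exfalso
          have h' : 2 * (j + 1) + 2 = 0 := by exact_mod_cast h
          omega
        · linear_combination h
    have v : ∀ j : ℤ, j ≤ 0 → E 0 j = 1 ∧ E 0 (j - 1) = 1 := by
      intro j hj
      induction j, hj using Int.leInductionDown with
      | base => exact ⟨h0, by simpa using hm⟩
      | pred j hj ih =>
        refine ⟨ih.2, ?_⟩
        have := hrec (j - 1)
        rw [sub_add_cancel, ih.1, ih.2, sub_self, mul_zero, mul_zero, zero_sub, zero_eq_neg, mul_eq_zero, mul_eq_zero] at this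
        rcases this with (h | h) | h
        · exfalso
          have h' : 2 * (j - 1) - 1 = 0 := by exact_mod_cast h
          omega
        · exfalso
          have h' : 2 * (j - 1) - 2 = 0 := by exact_mod_cast h
          omega
        · linear_combination h
    intro j
    rcases le_total 0 j with h | h
    · exact (u j h).1
    · exact (v j h).1
  intro i
  rcases le_total 0 i with hi | hi
  · induction i, hi using Int.leInduction with
    | base => exact row
    | succ i hi ih =>
      intro j
      have := h1 i j
      rw [ih, ih] at this
      have hn : (1 - 2 * i : ℂ) ≠ 0 := by
        intro h
        have h' : 1 - 2 * i = 0 := by exact_mod_cast h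
        omega
      apply mul_left_cancel₀ hn
      linear_combination this
  · induction i, hi using Int.leInductionDown with
    | base => exact row
    | pred i hi ih =>
      intro j
      have := h2 i j
      rw [ih, ih] at this
      have hn : (1 + 2 * i : ℂ) ≠ 0 := by
        intro h
        have h' : 1 + 2 * i = 0 := by exact_mod_cast h
        omega
      apply mul_left_cancel₀ hn
      linear_combination this

namespace SysGHD

variable {θ ε : ℂ} {G H D : ℂ → ℂ → ℂ}

lemma core (S : SysGHD θ ε G H D) {a : ℂ} (ha : InZT θ a) (ha0 : a ≠ 0)
    (f : ∀ t, InZT θ t → D a t = D (-a) t) {t : ℂ} (ht : InZT θ t) :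
    D a (2 * a + t) = D a t := by
  by_cases hta : t + a = 0
  · have : t = -a := by linear_combination hta
    subst this
    rw [show 2 * a + -a = a by ring, S.Drr ha, S.Dneg' ha]
  have ha' := S.neg_mem ha
  obtain ⟨k, hk⟩ := S.two_mem ha
  have hk' : ((-k : ℤ) : ℂ) = -2 * a := by push_cast; rw [hk]; ring
  have ht2 : InZT θ (2 * a + t) := by rw [← hk]; exact add_mem ht k
  have htn := S.neg_mem ht
  have ht2n : InZT θ (-2 * a - t) := by
    have := S.neg_mem ht2
    rwa [show -(2 * a + t) = -2 * a - t by ring] at this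
  have n1 := S.Dne ha ht
  have n2 := S.Dne ha ht2
  have n3 := S.Dne ha htn
  have n4 := S.Dne ha ht2n
  have hε1 : 1 + 2 * a * ε ≠ 0 := by
    have := S.ne ha
    rwa [show 1 + 2 * ε * a = 1 + 2 * a * ε by ring] at this
  have hε2 : 1 - 2 * a * ε ≠ 0 := by
    have := S.ne ha'
    rwa [show 1 + 2 * ε * (-a) = 1 - 2 * a * ε by ring] at this
  have g1 := S.Gd ha ht
  have g2 := S.Gd ha' ht2
  have g3 := S.Gd ha ht2n
  have g4 := S.Gd ha' htn
  rw [show 2 * -a = -2 * a by ring, show -2 * a + (2 * a + t) = t by ring, ← f _ ht, ← f _ ht2] at g2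
  rw [show 2 * a + (-2 * a - t) = -t by ring] at g3
  rw [show 2 * -a = -2 * a by ring, ← sub_eq_add_neg, ← f _ htn, ← f _ ht2n] at g4
  have h1 := S.e1 k t ht
  have h2 := S.e1 (-k) _ ht2
  have h3 := S.e1 k _ ht2n
  have h4 := S.e1 (-k) _ htn
  have hh := S.anti ht k
  have kk := S.anti ht2 (-k)
  have d1 := S.HD ht k
  have d2 := S.HD ht2 (-k)
  have d3 := S.HD ht2n k
  have d4 := S.HD htn (-k)
  have e := S.e2 _ _ ht ht2
  have e' := S.e2 _ _ ht2n htn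
  rw [hk'] at h2 h4 kk d2 d4
  rw [hk] at h1 h3 hh d1 d3
  rw [show -2 * a + (2 * a + t) = t by ring] at d2
  rw [show 2 * a + (-2 * a - t) = -t by ring] at d3
  rw [show -2 * a + -t = -2 * a - t by ring] at d4
  rw [show -(2 * a) - t = -2 * a - t by ring] at hh
  rw [show -(-2 * a) - (2 * a + t) = -t by ring] at kk
  have := coreAlg (ρ := D a t / D a (2 * a + t)) (σ := D a (-2 * a - t) / D a (-t))
    (g := G (2 * a) t) (p := G (-2 * a) (2 * a + t)) (g' := G (2 * a) (-2 * a - t))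
    (p' := G (-2 * a) (-t)) (h := H t (2 * a)) (k := H (2 * a + t) (-2 * a))
    (h' := H (-2 * a - t) (2 * a)) (k' := H (-t) (-2 * a))
    (d := D t (2 * a + t)) (c := D (2 * a + t) t) (d' := D (-2 * a - t) (-t))
    (c' := D (-t) (-2 * a - t)) hε1 hε2 ha0 hta (S.ne ht) (S.ne ht2n) (S.ne ht2) (S.ne htn)
    (div_ne_zero n1 n2) (div_ne_zero n4 n3)
    (by rw [← mul_div_assoc, eq_div_iff n2]; linear_combination g1)
    (by rw [← mul_div_assoc, div_eq_iff n2]; linear_combination g2)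
    (by rw [← mul_div_assoc, eq_div_iff n3]; linear_combination g3)
    (by rw [← mul_div_assoc, div_eq_iff n3]; linear_combination g4)
    (by linear_combination h1) (by linear_combination h2) (by linear_combination h3)
    (by linear_combination h4) (by linear_combination hh) (by linear_combination kk)
    (by linear_combination d1) (by linear_combination d2) (by linear_combination d3)
    (by linear_combination d4) (by linear_combination e) (by linear_combination e')
  rw [div_eq_one_iff_eq n2] at this
  exact this.symm

lemma Gval (S : SysGHD θ ε G H D) {a : ℂ} (ha : InZT θ a) (ha0 : a ≠ 0)
    (f : ∀ t, InZT θ t → D a t = D (-a) t) {t : ℂ} (ht : InZT θ t) :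
    G (2 * a) t = -(a + t) := by
  have h := S.Gd ha ht
  rw [S.core ha ha0 f ht] at h
  exact mul_right_cancel₀ (S.Dne ha ht) h

lemma Gval' (S : SysGHD θ ε G H D) {a : ℂ} (ha : InZT θ a) (ha0 : a ≠ 0)
    (f : ∀ t, InZT θ t → D a t = D (-a) t) {t : ℂ} (ht : InZT θ t) :
    G (-(2 * a)) t = a - t := by
  have h := S.Gval (S.neg_mem ha) (neg_ne_zero.mpr ha0)
    (fun t ht => by rw [neg_neg]; exact (f t ht).symm) ht
  rw [show 2 * -a = -(2 * a) by ring] at h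
  rw [h]; ring

/-- values on the odd multiples of a -/
lemma oddD (S : SysGHD θ ε G H D) {a : ℂ} (ha : InZT θ a) (ha0 : a ≠ 0)
    (f : ∀ t, InZT θ t → D a t = D (-a) t) :
    ∀ i j : ℤ, D ((2 * i + 1) * a) ((2 * j + 1) * a) = 1 := by
  obtain ⟨k, hk⟩ := S.two_mem ha
  have hk' : ((-k : ℤ) : ℂ) = -(2 * a) := by push_cast; rw [hk]
  have mem : ∀ i : ℤ, InZT θ ((2 * i + 1) * a) := by
    intro i
    have := add_mem ha (i * k)
    rwa [show (((i * k : ℤ) : ℂ) + a) = (2 * i + 1) * a by push_cast; rw [hk]; ring] at this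
  have row : ∀ j : ℤ, D a ((2 * j + 1) * a) = 1 := by
    intro j
    have st : ∀ j : ℤ, D a ((2 * (j + 1 : ℤ) + 1) * a) = D a ((2 * j + 1) * a) := by
      intro j
      rw [← S.core ha ha0 f (mem j)]
      congr 1
      push_cast
      ring
    induction j using Int.induction_on with
    | zero => simpa using S.Drr ha
    | succ j ih => rw [st, ih]
    | pred j ih =>
      have := st (-j - 1)
      rw [sub_add_cancel, ih] at this
      exact this.symm
  apply oddLattice (fun i j => D ((2 * i + 1) * a) ((2 * j + 1) * a))
  · intro i j
    have h := S.e5 k _ _ (mem i) (mem j)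
    rw [hk, S.Gval ha ha0 f (mem j)] at h
    apply mul_left_cancel₀ (mul_ne_zero two_ne_zero ha0)
    push_cast
    rw [show (2 * ((i : ℂ) + 1) + 1) * a = 2 * a + (2 * i + 1) * a by ring,
      show (2 * ((j : ℂ) + 1) + 1) * a = 2 * a + (2 * j + 1) * a by ring]
    linear_combination h
  · intro i j
    have h := S.e5 (-k) _ _ (mem i) (mem j)
    rw [hk', S.Gval' ha ha0 f (mem j)] at h
    apply mul_left_cancel₀ (mul_ne_zero two_ne_zero ha0)
    push_cast
    rw [show (2 * ((i : ℂ) - 1) + 1) * a = -(2 * a) + (2 * i + 1) * a by ring,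
      show (2 * ((j : ℂ) - 1) + 1) * a = -(2 * a) + (2 * j + 1) * a by ring]
    linear_combination h
  · intro j
    simpa using row j
  · intro j
    have := row j
    rw [f _ (mem j)] at this
    convert this using 2
    push_cast; ring
  · intro i
    have := S.Dneg' (mem i)
    convert this using 2
    push_cast; ring

lemma final (S : SysGHD θ ε G H D) {s t : ℂ} (hs : InZT θ s) (ht : InZT θ t)
    (h : D t (2 * s + t) = 1) : G (2 * s) t = -s - t ∧ H t (2 * s) = -2 * s := by
  obtain ⟨k, hk⟩ := S.two_mem hs
  have h1 := S.HD ht k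
  have h2 := S.e1 k t ht
  rw [hk] at h1 h2
  rw [h] at h1
  have h3 : H t (2 * s) = -2 * s := by linear_combination h1
  refine ⟨?_, h3⟩
  rw [h3] at h2
  apply mul_right_cancel₀ (S.ne ht)
  linear_combination h2

lemma caseHalf (S : SysGHD (1 / 2) ε G H D) {s t : ℂ} (hs : InZT (1 / 2) s)
    (ht : InZT (1 / 2) t) : D t (2 * s + t) = 1 := by
  have ha : InZT (1 / 2) (1 / 2) := ⟨0, by simp⟩
  have f : ∀ t, InZT (1 / 2) t → D (1 / 2) t = D (-(1 / 2)) t := by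
    rintro t ⟨j, rfl⟩
    have st : ∀ j : ℤ, j ≠ 0 → (D (1 / 2) ((j - 1 : ℤ) + 1 / 2) = D (-(1 / 2)) ((j - 1 : ℤ) + 1 / 2)
        ↔ D (1 / 2) (j + 1 / 2) = D (-(1 / 2)) (j + 1 / 2)) := by
      intro j hj
      rw [← S.fiff ha j hj, show (((j - 1 : ℤ) : ℂ) + 1 / 2) = j - 1 / 2 by push_cast; ring]
    have b0 : D (1 / 2) ((0 : ℤ) + 1 / 2) = D (-(1 / 2)) ((0 : ℤ) + 1 / 2) := by
      rw [Int.cast_zero, zero_add, S.Drr ha, S.Dneg ha]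
    have b1 : D (1 / 2) ((-1 : ℤ) + 1 / 2) = D (-(1 / 2)) ((-1 : ℤ) + 1 / 2) := by
      rw [show (((-1 : ℤ) : ℂ) + 1 / 2) = -(1 / 2) by push_cast; ring, S.Drr (S.neg_mem ha), S.Dneg' ha]
    rcases lt_or_ge j 0 with hj | hj
    · have hj' : j ≤ -1 := by omega
      clear hj
      induction j, hj' using Int.leInductionDown with
      | base => exact b1
      | pred j hj ih => exact (st j (by omega)).mpr ih
    · induction j, hj using Int.leInduction with
      | base => exact b0
      | succ j hj ih =>
        apply (st (j + 1) (by omega)).mp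
        rw [add_sub_cancel_right]
        exact ih
  obtain ⟨i, rfl⟩ := hs
  obtain ⟨j, rfl⟩ := ht
  have := S.oddD ha (by norm_num) f j (2 * i + j + 1)
  push_cast at this
  rw [show (2 * (j : ℂ) + 1) * (1 / 2) = j + 1 / 2 by ring,
    show (2 * (2 * (i : ℂ) + j + 1) + 1) * (1 / 2) = 2 * (i + 1 / 2) + (j + 1 / 2) by ring] at this
  exact this

lemma Dstep (S : SysGHD θ ε G H D) {a t : ℂ} (ha : InZT θ a) (ha0 : a ≠ 0) (ht : InZT θ t)
    (h : G (2 * a) t = -(a + t)) : D t (2 * a + t) = 1 := by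
  obtain ⟨k, hk⟩ := S.two_mem ha
  have h1 := S.HD ht k
  have h2 := S.e1 k t ht
  rw [hk] at h1 h2
  rw [h] at h2
  have h3 : H t (2 * a) = -2 * a := by
    apply mul_right_cancel₀ (S.ne ha)
    linear_combination -h2
  rw [h3] at h1
  apply mul_left_cancel₀ (mul_ne_zero (neg_ne_zero.mpr two_ne_zero) ha0)
  linear_combination h1

lemma zero_alg {P0 P2 Pm M0 M2 Mm g20 g2m gm0 gm2 h k d c ε : ℂ}
    (n1 : P0 ≠ 0) (n2 : P2 ≠ 0) (n4 : M0 ≠ 0)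
    (n6 : Mm ≠ 0) (hε : 1 + 4 * ε ≠ 0)
    (f1 : P0 * P2 + M2 * M0 = 2 * P2 * M0) (f2 : Pm * P0 + M0 * Mm = 2 * P0 * Mm)
    (a1 : g20 * P2 = -P0) (a2 : g2m * P0 = Pm) (a3 : gm0 * Mm = M0) (a4 : gm2 * M0 = -M2)
    (b : 0 = gm0 * g2m - g20 * gm2)
    (c1 : g20 - h * (1 + 2 * ε) = 1 + 4 * ε)
    (c2 : gm2 * (1 + 4 * ε) - k * (1 - 2 * ε) = -3)
    (d1 : h * d = -2) (d2 : k * c = 2)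
    (e : d * (1 + 4 * ε) + c = 2 + 4 * ε) : P0 = M0 := by
  have q : (P0 - M0) ^ 3 * (P0 + M0) = 0 := by
    have q1 : M0 * Pm * (P2 * M0) = P0 * M2 * (Mm * P0) := by
      linear_combination (-Mm * P0 * P2 * M0) * b - P2 * M0 * g2m * P0 * a3 - P2 * M0 * M0 * a2
        + Mm * P0 * gm2 * M0 * a1 - Mm * P0 * P0 * a4
    have := mul_ne_zero n2 n6
    apply mul_left_cancel₀ this
    linear_combination P0 * M0 * q1 - M0 ^ 3 * P2 * f2 + P0 ^ 3 * Mm * f1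
  rcases mul_eq_zero.mp q with q | q
  · exact sub_eq_zero.mp (pow_eq_zero_iff (three_ne_zero) |>.mp q)
  exfalso
  have hM : M0 = -P0 := by linear_combination q
  subst hM
  have hM2 : M2 = 3 * P2 := by
    apply mul_left_cancel₀ n1
    linear_combination -f1
  subst hM2
  have gg : g20 * gm2 = -3 := by
    apply mul_left_cancel₀ (mul_ne_zero n1 n2)
    linear_combination -gm2 * P0 * (-a1) + P0 * a4
  have n : g20 ≠ 0 := by
    rintro rfl
    simp at gg
  have hd : (1 + 4 * ε - g20) * d = 2 * (1 + 2 * ε) := by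
    linear_combination -(1 + 2 * ε) * d1 - d * c1
  have hc : 3 * (1 + 4 * ε - g20) * c = -2 * g20 * (1 - 2 * ε) := by
    linear_combination -g20 * (1 - 2 * ε) * d2 - g20 * c * c2 + c * (1 + 4 * ε) * gg
  have : g20 * (1 + 4 * ε) = 0 := by
    linear_combination (1/4 : ℂ) * (3 * (1 + 4 * ε - g20) * e - 3 * (1 + 4 * ε) * hd - hc)
  exact mul_ne_zero n hε this

lemma caseZero (S : SysGHD 0 ε G H D) {s t : ℂ} (hs : InZT 0 s)
    (ht : InZT 0 t) : D t (2 * s + t) = 1 := by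
  have mem : ∀ k : ℤ, InZT 0 (k : ℂ) := fun k => ⟨k, by simp⟩
  have ha : InZT 0 1 := by simpa using mem 1
  have h0 : InZT 0 0 := by simpa using mem 0
  have h2 : InZT 0 2 := by simpa using mem 2
  have hm2 : InZT 0 (-2) := by simpa using mem (-2)
  have ha' := S.neg_mem ha
  have f0 : D 1 0 = D (-1) 0 := by
    have f1 := S.frec ha 1 (by norm_num)
    have f2 := S.frec ha (-1) (by norm_num)
    have a1 := S.Gd ha h0
    have a2 := S.Gd ha hm2
    have a3 := S.Gd ha' h0
    have a4 := S.Gd ha' h2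
    have b := S.e3 2 (-2) 0 h0
    have c1 := S.e1 2 0 h0
    have c2 := S.e1 (-2) 2 h2
    have d1 := S.HD h0 2
    have d2 := S.HD h2 (-2)
    have e := S.e2 0 2 h0 h2
    have hε := S.hε 4
    have g0 := S.G0 h0
    norm_num at f1 f2 a1 a2 a3 a4 b c1 c2 d1 d2 e hε g0
    rw [g0] at b
    apply zero_alg (S.Dne ha h0) (S.Dne ha h2) (S.Dne ha' h0) (S.Dne ha' hm2)
      (ε := ε) (g20 := G 2 0) (g2m := G 2 (-2)) (gm0 := G (-2) 0) (gm2 := G (-2) 2) _ f1 f2 (by linear_combination a1) (by linear_combination a2)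
      (by linear_combination a3) (by linear_combination a4) (by linear_combination b)
      (by linear_combination c1) (by linear_combination c2) d1 d2 (by linear_combination e)
    intro h
    apply hε
    linear_combination h
  have f : ∀ t, InZT 0 t → D 1 t = D (-1) t := by
    have st : ∀ j : ℤ, j ≠ -1 → (D 1 j = D (-1) j ↔ D 1 (j + 2 : ℤ) = D (-1) (j + 2 : ℤ)) := by
      intro j hj
      have := S.fiff ha (j + 1) (by omega)
      push_cast at this ⊢
      rwa [add_sub_cancel_right, add_assoc, one_add_one_eq_two] at this
    have b1 : D 1 (1 : ℤ) = D (-1) (1 : ℤ) := by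
      rw [Int.cast_one, S.Drr ha, S.Dneg ha]
    have bm : D 1 (-1 : ℤ) = D (-1) (-1 : ℤ) := by
      rw [Int.cast_neg, Int.cast_one, S.Drr ha', S.Dneg' ha]
    have up : ∀ j : ℤ, 0 ≤ j → D 1 j = D (-1) j ∧ D 1 (j + 1 : ℤ) = D (-1) (j + 1 : ℤ) := by
      intro j hj
      induction j, hj using Int.leInduction with
      | base => exact ⟨by simpa using f0, by simpa using b1⟩
      | succ j hj ih =>
        refine ⟨ih.2, ?_⟩
        rw [add_assoc, one_add_one_eq_two]
        exact (st j (by omega)).mp ih.1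
    have dn : ∀ j : ℤ, j ≤ 0 → D 1 j = D (-1) j ∧ D 1 (j - 1 : ℤ) = D (-1) (j - 1 : ℤ) := by
      intro j hj
      induction j, hj using Int.leInductionDown with
      | base => exact ⟨by simpa using f0, by simpa using bm⟩
      | pred j hj ih =>
        refine ⟨ih.2, ?_⟩
        apply (st _ (by omega)).mpr
        rw [show j - 1 - 1 + 2 = j by ring]
        exact ih.1
    rintro t ⟨j, rfl⟩
    rw [add_zero]
    rcases le_total 0 j with h | h
    · exact (up j h).1
    · exact (dn j h).1
  obtain ⟨i, rfl⟩ := hs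
  obtain ⟨j, rfl⟩ := ht
  rw [add_zero, add_zero]
  rcases Int.even_or_odd' j with ⟨l, rfl | rfl⟩
  · have g1 : ∀ j : ℤ, G 2 (2 * j) = -(1 + 2 * j) := by
      intro j
      have := S.Gval ha one_ne_zero f (t := 2 * j) (by simpa using mem (2 * j))
      rwa [mul_one] at this
    have g2 : ∀ j : ℤ, G (-2) (2 * j) = 1 - 2 * j := by
      intro j
      have := S.Gval' ha one_ne_zero f (t := 2 * j) (by simpa using mem (2 * j))
      rwa [mul_one] at this
    have := evenLattice (fun i j => D (2 * i) (2 * j)) ?_ ?_ ?_ ?_ ?_ l (i + l)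
    · push_cast at this ⊢
      rwa [mul_add] at this
    · intro i j
      have h := S.e5 2 (2 * i) (2 * j) (by simpa using mem (2 * i)) (by simpa using mem (2 * j))
      push_cast at h ⊢
      rw [g1] at h
      rw [show 2 * ((i : ℂ) + 1) = 2 + 2 * i by ring, show 2 * ((j : ℂ) + 1) = 2 + 2 * j by ring]
      linear_combination h
    · intro i j
      have h := S.e5 (-2) (2 * i) (2 * j) (by simpa using mem (2 * i)) (by simpa using mem (2 * j))
      push_cast at h ⊢
      rw [g2] at h
      rw [show 2 * ((i : ℂ) - 1) = -2 + 2 * i by ring, show 2 * ((j : ℂ) - 1) = -2 + 2 * j by ring]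
      linear_combination -h
    · simpa using S.Drr h0
    · simpa using S.Dstep ha one_ne_zero h0 (S.Gval ha one_ne_zero f h0)
    · have := S.Dstep ha' (neg_ne_zero.mpr one_ne_zero) h0 (by
        have := S.Gval' ha one_ne_zero f h0
        rw [show (2 : ℂ) * -1 = -(2 * 1) by ring, this]; ring)
      simpa using this
  · have := S.oddD ha one_ne_zero f l (i + l)
    push_cast at this ⊢
    rw [mul_one, mul_one] at this
    rwa [show 2 * (i : ℂ) + (2 * l + 1) = 2 * (i + l) + 1 by ring]

end SysGHD

/-- under the normalized equations (3.6)–(3.12), G(2s,t) = −s−t and H(t,2s) = −2s (equation (3.19) and the identity preceding it). -/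
theorem G_H_even_values (θ ε : ℂ) (hθ : θ = 0 ∨ θ = 1 / 2)
    (hε : ∀ k : ℤ, 1 + ε * (k : ℂ) ≠ 0)
    (G H D : ℂ → ℂ → ℂ)
    (e1 : ∀ (m : ℤ) (r : ℂ), InZT θ r →
      G m r * (1 + 2 * ε * r) - H r m * (1 + ε * (m : ℂ))
        = ((m : ℂ) / 2 - r) * (1 + 2 * ε * ((m : ℂ) + r)))
    (e2 : ∀ r s : ℂ, InZT θ r → InZT θ s →
      D r s * (1 + 2 * ε * s) + D s r * (1 + 2 * ε * r) = 2 + 2 * ε * (r + s))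
    (e3 : ∀ (m n : ℤ) (r : ℂ), InZT θ r →
      ((m : ℂ) - (n : ℂ)) * G ((m : ℂ) + (n : ℂ)) r
        = G n r * G m ((n : ℂ) + r) - G m r * G n ((m : ℂ) + r))
    (e4 : ∀ (m n : ℤ) (r : ℂ), InZT θ r →
      ((m : ℂ) / 2 - r) * H ((m : ℂ) + r) n
        = H r n * G m ((n : ℂ) + r) + (n : ℂ) * H r ((m : ℂ) + (n : ℂ)))
    (e5 : ∀ (m : ℤ) (r s : ℂ), InZT θ r → InZT θ s →
      ((m : ℂ) / 2 - r) * D ((m : ℂ) + r) s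
        = -(r + s) * D r s - G m s * D r ((m : ℂ) + s))
    (e6 : ∀ (m : ℤ) (r s : ℂ), InZT θ r → InZT θ s →
      -2 * (m : ℂ) = H s m * D r ((m : ℂ) + s) + H r m * D s ((m : ℂ) + r))
    (e7 : ∀ r s t : ℂ, InZT θ r → InZT θ s → InZT θ t →
      2 * G (r + s) t = D s t * H r (s + t) + D r t * H s (r + t)) :
    ∀ s t : ℂ, InZT θ s → InZT θ t →
      G (2 * s) t = -s - t ∧ H t (2 * s) = -2 * s := by
  have S : SysGHD θ ε G H D := ⟨hθ, hε, e1, e2, e3, e5, e6, e7⟩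
  intro s t hs ht
  apply S.final hs ht
  rcases hθ with rfl | rfl
  · exact S.caseZero hs ht
  · exact S.caseHalf hs ht
end

section
/- Let θ = 1/2 and let ε ∈ ℂ with 1+εk ≠ 0 for every integer k. Suppose G: ℤ×(ℤ+1/2) → ℂ, H: (ℤ+1/2)×ℤ → ℂ, D: (ℤ+1/2)×(ℤ+1/2) → ℂ satisfy, for all m,n ∈ ℤ and r,s,t ∈ ℤ+1/2: G(m,r)(1+2εr) − H(r,m)(1+εm) = (m/2−r)(1+2ε(m+r)); D(r,s)(1+2εs) + D(s,r)(1+2εr) = 2+2ε(r+s); (m−n)G(m+n,r) = G(n,r)G(m,n+r) − G(m,r)G(n,m+r); (m/2−r)H(m+r,n) = H(r,n)G(m,n+r) + n·H(r,m+n); (m/2−r)D(m+r,s) = −(r+s)D(r,s) − G(m,s)D(r,m+s); −2m = H(s,m)D(r,m+s) + H(r,m)D(s,m+r); 2G(r+s,t) = D(s,t)H(r,s+t) + D(r,t)H(s,r+t). Then D(r,s) = 1 for all r,s ∈ ℤ+1/2, and consequently H(r,m) = −m and G(m,r) = −m/2 − r for all m ∈ ℤ, r ∈ ℤ+1/2.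 -/
/-- Case (I) (θ = 1/2, Neveu–Schwarz) in the proof of Theorem 3.2: under the normalized equations (3.6)–(3.12), D ≡ 1, H(r,m) = −m and G(m,r) = −m/2 − r. -/
theorem NS_case_D_one (θ ε : ℂ) (hθ : θ = 1 / 2)
    (hε : ∀ k : ℤ, 1 + ε * (k : ℂ) ≠ 0)
    (G H D : ℂ → ℂ → ℂ)
    (e1 : ∀ (m : ℤ) (r : ℂ), InZT θ r →
      G m r * (1 + 2 * ε * r) - H r m * (1 + ε * (m : ℂ))
        = ((m : ℂ) / 2 - r) * (1 + 2 * ε * ((m : ℂ) + r)))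
    (e2 : ∀ r s : ℂ, InZT θ r → InZT θ s →
      D r s * (1 + 2 * ε * s) + D s r * (1 + 2 * ε * r) = 2 + 2 * ε * (r + s))
    (e3 : ∀ (m n : ℤ) (r : ℂ), InZT θ r →
      ((m : ℂ) - (n : ℂ)) * G ((m : ℂ) + (n : ℂ)) r
        = G n r * G m ((n : ℂ) + r) - G m r * G n ((m : ℂ) + r))
    (e4 : ∀ (m n : ℤ) (r : ℂ), InZT θ r →
      ((m : ℂ) / 2 - r) * H ((m : ℂ) + r) n
        = H r n * G m ((n : ℂ) + r) + (n : ℂ) * H r ((m : ℂ) + (n : ℂ)))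
    (e5 : ∀ (m : ℤ) (r s : ℂ), InZT θ r → InZT θ s →
      ((m : ℂ) / 2 - r) * D ((m : ℂ) + r) s
        = -(r + s) * D r s - G m s * D r ((m : ℂ) + s))
    (e6 : ∀ (m : ℤ) (r s : ℂ), InZT θ r → InZT θ s →
      -2 * (m : ℂ) = H s m * D r ((m : ℂ) + s) + H r m * D s ((m : ℂ) + r))
    (e7 : ∀ r s t : ℂ, InZT θ r → InZT θ s → InZT θ t →
      2 * G (r + s) t = D s t * H r (s + t) + D r t * H s (r + t)) :
    (∀ r s : ℂ, InZT θ r → InZT θ s → D r s = 1) ∧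
      ∀ (m : ℤ) (r : ℂ), InZT θ r →
        H r m = -(m : ℂ) ∧ G m r = -(m : ℂ) / 2 - r := by
  subst hθ
  have hA : ∀ r, InZT (1 / 2) r → 1 + 2 * ε * r ≠ 0 := by
    rintro r ⟨k, rfl⟩ h
    apply hε (2 * k + 1)
    push_cast
    linear_combination h
  have hr0 : ∀ r, InZT (1 / 2) r → r ≠ 0 := by
    rintro r ⟨k, rfl⟩ h
    have h1 : ((2 * k + 1 : ℤ) : ℂ) = 0 := by push_cast; linear_combination 2 * h
    have h2 : 2 * k + 1 = 0 := by exact_mod_cast h1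
    omega
  have hadd : ∀ (r : ℂ) (m : ℤ), InZT (1 / 2) r → InZT (1 / 2) (r + m) := by
    rintro r m ⟨k, rfl⟩
    exact ⟨k + m, by push_cast; ring⟩
  have hneg : ∀ (r : ℂ), InZT (1 / 2) r → InZT (1 / 2) (-r) := by
    rintro r ⟨k, rfl⟩
    exact ⟨-k - 1, by push_cast; ring⟩
  have h3 : ∀ (r : ℂ), InZT (1 / 2) r → InZT (1 / 2) (3 * r) := by
    rintro r ⟨k, rfl⟩
    exact ⟨3 * k + 1, by push_cast; ring⟩
  have h2 : ∀ (r : ℂ), InZT (1 / 2) r → ∃ m : ℤ, 2 * r = m := by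
    rintro r ⟨k, rfl⟩
    exact ⟨2 * k + 1, by push_cast; ring⟩
  -- the diagonal
  have Drr : ∀ r, InZT (1 / 2) r → D r r = 1 := by
    intro r hr
    have h := e2 r r hr hr
    apply mul_right_cancel₀ (hA r hr)
    linear_combination h / 2
  -- equation (3.11) with equal arguments
  have HD : ∀ (m : ℤ) (z r s : ℂ), InZT (1 / 2) r → z = m → s = m + r → H r z * D r s = -z := by
    rintro m z r s hr rfl rfl
    have h := e6 m r r hr hr
    linear_combination -h / 2
  have H0 : ∀ r, InZT (1 / 2) r → H r 0 = 0 := by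
    intro r hr
    have h := HD 0 0 r r hr (by simp) (by simp)
    rw [Drr r hr] at h
    linear_combination h
  have flip : ∀ r s, InZT (1 / 2) r → InZT (1 / 2) s → D r s = 1 → D s r = 1 := by
    intro r s hr hs h
    have h' := e2 r s hr hs
    rw [h] at h'
    apply mul_right_cancel₀ (hA r hr)
    linear_combination h'
  have HG : ∀ (m : ℤ) (r : ℂ), InZT (1 / 2) r → D r (m + r) = 1 →
      H r m = -(m : ℂ) ∧ G m r = -(m : ℂ) / 2 - r := by
    intro m r hr h
    have h1 := HD m m r _ hr rfl rfl
    rw [h] at h1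
    have h2 : H r m = -(m : ℂ) := by linear_combination h1
    refine ⟨h2, ?_⟩
    have h3 := e1 m r hr
    rw [h2] at h3
    apply mul_right_cancel₀ (hA r hr)
    linear_combination h3
  have Dne : ∀ (m : ℤ) (r s : ℂ), InZT (1 / 2) r → s = m + r → D r s ≠ 0 := by
    intro m r s hr hs h
    have h1 := HD m m r s hr rfl hs
    rw [h] at h1
    have h2 : (m : ℂ) = 0 := by linear_combination h1
    rw [h2, zero_add] at hs
    rw [hs, Drr r hr] at h
    exact one_ne_zero h
  -- the antidiagonal
  have Dneg : ∀ r, InZT (1 / 2) r → D (-r) r = 1 := by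
    intro r hr
    obtain ⟨m, hm⟩ := h2 r hr
    have a1 := e7 r r (-r) hr hr (hneg r hr)
    rw [add_neg_cancel, H0 r hr, show r + r = m by rw [← hm]; ring] at a1
    have a2 := e1 m (-r) (hneg r hr)
    have a3 := HD m m (-r) r (hneg r hr) rfl (by rw [← hm]; ring)
    have a4 : G m (-r) = 0 := by linear_combination a1 / 2
    rw [a4] at a2
    rw [← hm] at a2 a3
    have a5 : H (-r) (2 * r) = -(2 * r) := by
      apply mul_right_cancel₀ (hA r hr)
      linear_combination -a2
    rw [a5] at a3
    have := hr0 r hr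
    have h2r : -(2 * r) ≠ 0 := by simpa using this
    apply mul_left_cancel₀ h2r
    linear_combination a3
  -- the key base value
  have D3 : ∀ r, InZT (1 / 2) r → D (3 * r) r = 1 := by
    intro r hr
    have hn := hneg r hr
    have ht := h3 r hr
    have hne := hr0 r hr
    obtain ⟨m, hm⟩ := h2 r hr
    have dn := Dneg r hr
    have dn' := flip _ _ hn hr dn
    have b1 := e4 (-m) m r hr
    have b2 := e1 (-m) (3 * r) ht
    have b3 := HD m m r (3 * r) hr rfl (by rw [← hm]; ring)
    have b4 := HD (-m) (-m) (3 * r) r ht (by push_cast; rfl) (by push_cast; rw [← hm]; ring)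
    have b5 := e6 m r (-r) hr hn
    have b6 := e6 (-m) (3 * r) r ht hr
    have b7 := e2 (3 * r) (-r) ht hn
    have b8 := HD m m (-r) r hn rfl (by rw [← hm]; ring)
    have b9 := HD (-m) (-m) r (-r) hr (by push_cast; rfl) (by push_cast; rw [← hm]; ring)
    push_cast at b1 b2 b3 b4 b5 b6 b8 b9
    rw [← hm] at b1 b2 b3 b4 b5 b6 b8 b9
    rw [show -(2 * r) + r = -r by ring, show 2 * r + r = 3 * r by ring,
      show -(2 * r) + 2 * r = 0 by ring, H0 r hr] at b1
    rw [show 2 * r + -r = r by ring, show 2 * r + r = 3 * r by ring, Drr r hr] at b5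
    rw [show -(2 * r) + r = -r by ring, show -(2 * r) + 3 * r = r by ring, Drr r hr] at b6
    rw [dn] at b8
    rw [dn'] at b9
    have x0 : D r (3 * r) ≠ 0 := Dne m r _ hr (by rw [← hm]; ring)
    have v0 : D (3 * r) r ≠ 0 := Dne (-m) _ _ ht (by push_cast; rw [← hm]; ring)
    have am := hA _ hn
    generalize D r (3 * r) = x at *
    generalize D (3 * r) r = v at *
    generalize D (-r) (3 * r) = p at *
    generalize D (3 * r) (-r) = q at *
    generalize H r (2 * r) = hx at *
    generalize H (3 * r) (-(2 * r)) = hv at *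
    generalize H (-r) (2 * r) = h1 at *
    generalize H r (-(2 * r)) = h2 at *
    generalize G (-(2 * r)) (3 * r) = g at *
    have c8 : h1 = -(2 * r) := by linear_combination b8
    have c9 : h2 = 2 * r := by linear_combination b9
    subst c8 c9
    have hx0 : hx ≠ 0 := by
      rintro rfl
      apply hne
      linear_combination b3 / 2
    have cp : p = x := by
      apply mul_left_cancel₀ hx0
      linear_combination -b5 - b3
    have cg : g = -(2 * r * x) := by
      apply mul_left_cancel₀ hx0
      linear_combination -b1 + 2 * r * b3
    have cv : hv * v = 2 * r := by linear_combination b4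
    have cq : 2 * r * q = 4 * r - hv := by linear_combination -b6
    subst cp cg
    have key : hv = 2 * r := by
      have h2' : (2 : ℂ) ≠ 0 := two_ne_zero
      apply mul_right_cancel₀ (mul_ne_zero h2' am)
      linear_combination -b2 - 2 * r * b7 + (1 + 2 * ε * -r) * cq
    rw [key] at cv
    apply mul_left_cancel₀ (mul_ne_zero two_ne_zero hne : (2 * r : ℂ) ≠ 0)
    linear_combination cv
  have hm1 : ∀ r, InZT (1 / 2) r → InZT (1 / 2) (r - 1) := by
    intro r hr
    have := hadd r (-1) hr
    push_cast at this
    rwa [← sub_eq_add_neg] at this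
  have hp1 : ∀ r, InZT (1 / 2) r → InZT (1 / 2) (r + 1) := by
    intro r hr
    have := hadd r 1 hr
    push_cast at this
    exact this
  have up : ∀ r, InZT (1 / 2) r → r ≠ 1 / 2 → D (r - 1) r = 1 → D r (r + 1) = 1 := by
    intro r hr hne h
    have f := flip _ _ (hm1 r hr) hr h
    have g1 := (HG 1 (r - 1) (hm1 r hr) (by push_cast; rw [show 1 + (r - 1) = r by ring]; exact h)).2
    have g2 := (HG (-1) r hr (by push_cast; rw [show -1 + r = r - 1 by ring]; exact f)).1
    have g3 := e4 1 (-1) r hr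
    have g4 := HD (-1) (-1) (r + 1) r (hp1 r hr) (by simp) (by push_cast; ring)
    push_cast at g1 g2 g3
    rw [show -1 + r = r - 1 by ring, g1, g2, show (1 : ℂ) + -1 = 0 by ring, H0 r hr,
      add_comm 1 r] at g3
    apply flip _ _ (hp1 r hr) hr
    have g5 : H (r + 1) (-1) = 1 := by
      apply mul_left_cancel₀ (sub_ne_zero.2 (Ne.symm hne))
      linear_combination g3
    rw [g5] at g4
    linear_combination g4
  have down : ∀ r, InZT (1 / 2) r → r ≠ -(1 / 2) → D r (r + 1) = 1 → D (r - 1) r = 1 := by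
    intro r hr hne h
    have f := flip _ _ hr (hp1 r hr) h
    have g1 := (HG (-1) (r + 1) (hp1 r hr)
      (by push_cast; rw [show -1 + (r + 1) = r by ring]; exact f)).2
    have g2 := (HG 1 r hr (by push_cast; rw [add_comm]; exact h)).1
    have g3 := e4 (-1) 1 r hr
    have g4 := HD 1 1 (r - 1) r (hm1 r hr) (by simp) (by push_cast; ring)
    push_cast at g1 g2 g3
    rw [show -1 + r = r - 1 by ring, add_comm 1 r, g1, g2, show (-1 : ℂ) + 1 = 0 by ring,
      H0 r hr] at g3
    have g5 : H (r - 1) 1 = -1 := by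
      apply mul_left_cancel₀ (sub_ne_zero.2 (Ne.symm hne))
      linear_combination g3
    rw [g5] at g4
    linear_combination -g4
  have hh : InZT (1 / 2) (1 / 2) := ⟨0, by simp⟩
  have hZ : ∀ k : ℤ, InZT (1 / 2) ((k : ℂ) + 1 / 2) := fun k => ⟨k, rfl⟩
  have pos : ∀ n : ℕ, D ((n : ℂ) + 1 / 2) ((n : ℂ) + 1 / 2 + 1) = 1 := by
    intro n
    induction n with
    | zero =>
      have h := flip _ _ (h3 _ hh) hh (D3 _ hh)
      convert h using 2 <;> push_cast <;> ring
    | succ n ih =>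
      apply up
      · exact_mod_cast hZ (n + 1)
      · intro h
        have : ((n + 1 : ℕ) : ℂ) = 0 := by linear_combination h
        exact absurd this (by exact_mod_cast Nat.succ_ne_zero n)
      · convert ih using 2 <;> push_cast <;> ring
  have negc : ∀ n : ℕ, D (-(n : ℂ) - 3 / 2) (-(n : ℂ) - 3 / 2 + 1) = 1 := by
    intro n
    induction n with
    | zero =>
      have h := D3 _ (hneg _ hh)
      convert h using 2 <;> push_cast <;> ring
    | succ n ih =>
      have h := down (-(n : ℂ) - 3 / 2) ⟨-n - 2, by push_cast; ring⟩ (by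
        intro h
        have : ((n + 1 : ℕ) : ℂ) = 0 := by push_cast; linear_combination -h
        exact absurd this (by exact_mod_cast Nat.succ_ne_zero n)) ih
      convert h using 2 <;> push_cast <;> ring
  have D1 : ∀ r, InZT (1 / 2) r → D r (r + 1) = 1 := by
    rintro r ⟨k, rfl⟩
    rcases lt_trichotomy k (-1) with hk | hk | hk
    · obtain ⟨n, hn⟩ := Int.eq_ofNat_of_zero_le (show 0 ≤ -k - 2 by omega)
      have hk' : k = -(n : ℤ) - 2 := by omega
      subst hk'
      convert negc n using 2 <;> push_cast <;> ring
    · subst hk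
      convert Dneg _ hh using 2 <;> push_cast <;> ring
    · obtain ⟨n, hn⟩ := Int.eq_ofNat_of_zero_le (show 0 ≤ k by omega)
      subst hn
      exact_mod_cast pos n
  have G1 : ∀ r, InZT (1 / 2) r → G 1 r = -1 / 2 - r := by
    intro r hr
    have h := (HG 1 r hr (by push_cast; rw [add_comm]; exact D1 r hr)).2
    push_cast at h
    exact h
  have Gm1 : ∀ r, InZT (1 / 2) r → G (-1) r = 1 / 2 - r := by
    intro r hr
    have h1 := flip _ _ (hm1 r hr) (hp1 _ (hm1 r hr)) (D1 _ (hm1 r hr))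
    rw [sub_add_cancel] at h1
    have h := (HG (-1) r hr (by push_cast; rw [show -1 + r = r - 1 by ring]; exact h1)).2
    push_cast at h
    rw [h]
    ring
  have main : ∀ n : ℕ, (∀ r, InZT (1 / 2) r → D r (r + n) = 1) ∧
      (∀ r, InZT (1 / 2) r → D r (r + n + 1) = 1) := by
    intro n
    induction n with
    | zero =>
      refine ⟨fun r hr => ?_, fun r hr => ?_⟩
      · simpa using Drr r hr
      · simpa using D1 r hr
    | succ n ih =>
      obtain ⟨ih0, ih1⟩ := ih
      refine ⟨fun r hr => ?_, fun r hr => ?_⟩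
      · convert ih1 r hr using 2
        push_cast; ring
      have hs : InZT (1 / 2) (r + n + 1) := by
        have := hadd r (n + 1) hr
        push_cast at this
        rwa [← add_assoc] at this
      push_cast
      by_cases hc : 1 / 2 + (r + n + 1) = 0
      · have hrr : r + n + 2 = 1 / 2 := by linear_combination hc
        rw [show r + ((n : ℂ) + 1) + 1 = r + n + 2 by ring, hrr]
        apply flip _ _ hh hr
        have k1 := e5 (-1) (1 / 2) (r + 1) hh (hp1 r hr)
        have k2 := ih1 (r + 1) (hp1 r hr)
        rw [show r + 1 + (n : ℂ) + 1 = 1 / 2 by linear_combination hrr] at k2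
        have k2' := flip _ _ (hp1 r hr) hh k2
        have k3 := ih0 (r + 1) (hp1 r hr)
        rw [show r + 1 + (n : ℂ) = -1 + 1 / 2 by linear_combination hrr] at k3
        have k3' := flip _ _ (hp1 r hr) (by
          have := hm1 _ hh
          rwa [sub_eq_add_neg, add_comm] at this) k3
        push_cast at k1
        rw [k2', k3', Gm1 _ (hp1 r hr), show -1 + (r + 1) = r by ring] at k1
        have hn0 : r + 1 / 2 ≠ 0 := by
          intro h
          have : ((n + 1 : ℕ) : ℂ) = 0 := by push_cast; linear_combination hrr - h
          exact absurd this (by exact_mod_cast Nat.succ_ne_zero n)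
        apply mul_left_cancel₀ hn0
        linear_combination -k1
      · have k1 := e5 1 r (r + n + 1) hr hs
        have k2 := ih1 r hr
        have k3 := ih0 (r + 1) (hp1 r hr)
        push_cast at k1
        rw [show 1 + r = r + 1 by ring, show D (r + 1) (r + n + 1) = 1 by
          rw [show r + (n : ℂ) + 1 = r + 1 + n by ring]; exact k3, k2, G1 _ hs,
          show 1 + (r + (n : ℂ) + 1) = r + (n + 1) + 1 by ring] at k1
        apply mul_left_cancel₀ hc
        linear_combination -k1
  have Dall : ∀ r s : ℂ, InZT (1 / 2) r → InZT (1 / 2) s → D r s = 1 := by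
    intro r s hr hs
    obtain ⟨k, hk⟩ := id hr
    obtain ⟨l, hl⟩ := id hs
    rcases le_total k l with h | h
    · obtain ⟨n, hn⟩ := Int.eq_ofNat_of_zero_le (sub_nonneg.2 h)
      have hn' : l = k + n := by omega
      have : s = r + n := by rw [hk, hl, hn']; push_cast; ring
      rw [this]
      exact (main n).1 r hr
    · obtain ⟨n, hn⟩ := Int.eq_ofNat_of_zero_le (sub_nonneg.2 h)
      have hn' : k = l + n := by omega
      have : r = s + n := by rw [hk, hl, hn']; push_cast; ring
      apply flip _ _ hs hr
      rw [this]
      exact (main n).1 s hs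
  refine ⟨Dall, fun m r hr => HG m r hr (Dall _ _ hr ?_)⟩
  rw [add_comm]
  exact hadd r m hr
end
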